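/- arXiv:2105.05315 — 2 statements merged into one kernel-verified Lean document; each statement's English description precedes it below -/
import Mathlib

section
/- Let D be a strongly first order, relativizable generalized dependency, and suppose (M,R) ∈ D. Then R is contained in some R' such that (M,R') ∈ D_max. Moreover, there exists a first-order sentence D^m(R) of the form ⋁_{i=1}^n ∃ȳ ∀x̄ (R x̄ ↔ θᵢ(x̄, ȳ)), where each θᵢ is a first-order formula over the empty signature, such that whenever (M,R) ∈ D_max then (M,R) ⊨ D^m(R). -/
namespace DSFO

/-- A purely relational signature: for each arity, a type of relation symbols. -/
abbrev Signature := ℕ → Type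

/-- The empty signature. -/
def Sig0 : Signature := fun _ => Empty

/-- The signature with a single `k`-ary relation symbol `R`. -/
def SigR (k : ℕ) : Signature := fun n => PLift (n = k)

/-- Syntax of team-semantics formulas (in negation normal form, with the two
additional connectives: global disjunction `gdisj` and contradictory negation
`cneg`) over a relational signature `S`, with generalized dependency atoms
indexed by `ι` with arities `ar`.  Variables are natural numbers. -/
inductive TS (S : Signature) (ι : Type) (ar : ι → ℕ) : Type
  | rel {k : ℕ} (r : S k) (v : Fin k → ℕ)
  | nrel {k : ℕ} (r : S k) (v : Fin k → ℕ)
  | eq (x y : ℕ)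
  | neq (x y : ℕ)
  | dep (i : ι) (v : Fin (ar i) → ℕ)
  | and (φ ψ : TS S ι ar)
  | or (φ ψ : TS S ι ar)
  | gdisj (φ ψ : TS S ι ar)
  | cneg (φ : TS S ι ar)
  | ex (v : ℕ) (φ : TS S ι ar)
  | al (v : ℕ) (φ : TS S ι ar)

/-- The always-true literal `⊤`. -/
def TS.top {S : Signature} {ι : Type} {ar : ι → ℕ} : TS S ι ar := .eq 0 0

/-- The arity function for "no dependency atoms". -/
def noAtoms : Empty → ℕ := fun e => e.elim

/-- First-order formulas over `S` (no dependency atoms; here `cneg` plays the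
role of ordinary classical negation and `gdisj` of ordinary disjunction, so
this is full first-order logic). -/
abbrev FOF (S : Signature) := TS S Empty noAtoms

/-- First-order formulas over the empty signature. -/
abbrev EF := FOF Sig0

/-- Free variables of a formula. -/
def fv {S : Signature} {ι : Type} {ar : ι → ℕ} : TS S ι ar → Set ℕ
  | .rel _ v => Set.range v
  | .nrel _ v => Set.range v
  | .eq x y => {x, y}
  | .neq x y => {x, y}
  | .dep _ v => Set.range v
  | .and φ ψ => fv φ ∪ fv ψ
  | .or φ ψ => fv φ ∪ fv ψ
  | .gdisj φ ψ => fv φ ∪ fv ψ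
  | .cneg φ => fv φ
  | .ex v φ => fv φ \ {v}
  | .al v φ => fv φ \ {v}

/-- A sentence is a formula with no free variables. -/
def IsSentence {S : Signature} {ι : Type} {ar : ι → ℕ} (φ : TS S ι ar) : Prop :=
  fv φ = ∅

/-- No global disjunctions occur. -/
def NoGdisj {S : Signature} {ι : Type} {ar : ι → ℕ} : TS S ι ar → Prop
  | .rel _ _ => True
  | .nrel _ _ => True
  | .eq _ _ => True
  | .neq _ _ => True
  | .dep _ _ => True
  | .and φ ψ => NoGdisj φ ∧ NoGdisj ψ
  | .or φ ψ => NoGdisj φ ∧ NoGdisj ψ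
  | .gdisj _ _ => False
  | .cneg φ => NoGdisj φ
  | .ex _ φ => NoGdisj φ
  | .al _ φ => NoGdisj φ

/-- No contradictory negations occur. -/
def NoCneg {S : Signature} {ι : Type} {ar : ι → ℕ} : TS S ι ar → Prop
  | .rel _ _ => True
  | .nrel _ _ => True
  | .eq _ _ => True
  | .neq _ _ => True
  | .dep _ _ => True
  | .and φ ψ => NoCneg φ ∧ NoCneg ψ
  | .or φ ψ => NoCneg φ ∧ NoCneg ψ
  | .gdisj φ ψ => NoCneg φ ∧ NoCneg ψ
  | .cneg _ => False
  | .ex _ φ => NoCneg φ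
  | .al _ φ => NoCneg φ

/-- Formulas of `FO(𝒟)` proper: no `gdisj` and no `cneg`. -/
def Plain {S : Signature} {ι : Type} {ar : ι → ℕ} (φ : TS S ι ar) : Prop :=
  NoCneg φ ∧ NoGdisj φ

/-- Atomic formulas: first-order literals and dependency atoms. -/
def Atomic {S : Signature} {ι : Type} {ar : ι → ℕ} : TS S ι ar → Prop
  | .rel _ _ => True
  | .nrel _ _ => True
  | .eq _ _ => True
  | .neq _ _ => True
  | .dep _ _ => True
  | _ => False

/-- Formulas of `FO(∼₀, 𝒟)`: the contradictory negation may appear only in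
front of first-order literals and dependency atoms (and there is no `gdisj`). -/
def Cneg0 {S : Signature} {ι : Type} {ar : ι → ℕ} : TS S ι ar → Prop
  | .rel _ _ => True
  | .nrel _ _ => True
  | .eq _ _ => True
  | .neq _ _ => True
  | .dep _ _ => True
  | .and φ ψ => Cneg0 φ ∧ Cneg0 ψ
  | .or φ ψ => Cneg0 φ ∧ Cneg0 ψ
  | .gdisj _ _ => False
  | .cneg φ => Atomic φ
  | .ex _ φ => Cneg0 φ
  | .al _ φ => Cneg0 φ

/-- The negation normal form of the (dual) negation of a formula. -/
def TS.nneg {S : Signature} {ι : Type} {ar : ι → ℕ} : TS S ι ar → TS S ι ar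
  | .rel r v => .nrel r v
  | .nrel r v => .rel r v
  | .eq x y => .neq x y
  | .neq x y => .eq x y
  | .dep i v => .cneg (.dep i v)
  | .and φ ψ => .or (TS.nneg φ) (TS.nneg ψ)
  | .or φ ψ => .and (TS.nneg φ) (TS.nneg ψ)
  | .gdisj φ ψ => .and (TS.nneg φ) (TS.nneg ψ)
  | .cneg φ => φ
  | .ex v φ => .al v (TS.nneg φ)
  | .al v φ => .ex v (TS.nneg φ)

/-- Iterated existential quantification over a list of variables. -/
def exs {S : Signature} {ι : Type} {ar : ι → ℕ} (l : List ℕ) (φ : TS S ι ar) :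
    TS S ι ar := l.foldr TS.ex φ

/-- An interpretation of a relational signature in a domain `M`. -/
abbrev Interp (S : Signature) (M : Type) := ∀ k, S k → Set (Fin k → M)

/-- The unique interpretation of the empty signature. -/
def eI (M : Type) : Interp Sig0 M := fun _ e => e.elim

/-- The interpretation of `SigR k` given by a `k`-ary relation `R`. -/
def interpR {k : ℕ} {M : Type} (R : Set (Fin k → M)) : Interp (SigR k) M :=
  fun _ r => {s | (fun i => s (Fin.cast r.down.symm i)) ∈ R}

/-- Tarskian (single-assignment) satisfaction.  Dependency atoms are
(vacuously) interpreted as true; this is only used on first-order formulas. -/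
def FSat {S : Signature} {ι : Type} {ar : ι → ℕ} (M : Type) (I : Interp S M) :
    (ℕ → M) → TS S ι ar → Prop
  | s, .rel r v => (fun i => s (v i)) ∈ I _ r
  | s, .nrel r v => (fun i => s (v i)) ∉ I _ r
  | s, .eq x y => s x = s y
  | s, .neq x y => s x ≠ s y
  | _, .dep _ _ => True
  | s, .and φ ψ => FSat M I s φ ∧ FSat M I s ψ
  | s, .or φ ψ => FSat M I s φ ∨ FSat M I s ψ
  | s, .gdisj φ ψ => FSat M I s φ ∨ FSat M I s ψ
  | s, .cneg φ => ¬ FSat M I s φ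
  | s, .ex v φ => ∃ m : M, FSat M I (Function.update s v m) φ
  | s, .al v φ => ∀ m : M, FSat M I (Function.update s v m) φ

/-- Truth of a first-order sentence (Tarskian semantics). -/
def FOTrue {S : Signature} {ι : Type} {ar : ι → ℕ} (M : Type) (I : Interp S M)
    (φ : TS S ι ar) : Prop :=
  ∀ s : ℕ → M, FSat M I s φ

/-- The relation `X(x̄)` determined by a team `X` and a tuple of variables `x̄`. -/
def teamProj {M : Type} {k : ℕ} (v : Fin k → ℕ) (X : Set (ℕ → M)) :
    Set (Fin k → M) := {t | ∃ s ∈ X, t = fun j => s (v j)}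

/-- (Lax) team semantics.  `A` gives the semantics of each dependency atom as a
function of the relation `X(x̄)`. -/
def TSat {S : Signature} {ι : Type} {ar : ι → ℕ} (M : Type) (I : Interp S M)
    (A : ∀ i, Set (Fin (ar i) → M) → Prop) :
    TS S ι ar → Set (ℕ → M) → Prop
  | .rel r v, X => ∀ s ∈ X, (fun i => s (v i)) ∈ I _ r
  | .nrel r v, X => ∀ s ∈ X, (fun i => s (v i)) ∉ I _ r
  | .eq x y, X => ∀ s ∈ X, s x = s y
  | .neq x y, X => ∀ s ∈ X, s x ≠ s y
  | .dep i v, X => A i (teamProj v X)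
  | .and φ ψ, X => TSat M I A φ X ∧ TSat M I A ψ X
  | .or φ ψ, X => ∃ Y Z : Set (ℕ → M), Y ∪ Z = X ∧ TSat M I A φ Y ∧ TSat M I A ψ Z
  | .gdisj φ ψ, X => TSat M I A φ X ∨ TSat M I A ψ X
  | .cneg φ, X => ¬ TSat M I A φ X
  | .ex v φ, X => ∃ H : (ℕ → M) → Set M, (∀ s ∈ X, (H s).Nonempty) ∧
      TSat M I A φ {s' | ∃ s ∈ X, ∃ m ∈ H s, s' = Function.update s v m}
  | .al v φ, X => TSat M I A φ {s' | ∃ s ∈ X, ∃ m : M, s' = Function.update s v m}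

/-- Truth of a sentence under team semantics: satisfaction by the team of all
assignments (by locality, equivalent to satisfaction by `{∅}`). -/
def TTrue {S : Signature} {ι : Type} {ar : ι → ℕ} (M : Type) (I : Interp S M)
    (A : ∀ i, Set (Fin (ar i) → M) → Prop) (φ : TS S ι ar) : Prop :=
  TSat M I A φ Set.univ

/-- A `k`-ary dependency predicate: a class of pairs `(M, R)`. -/
abbrev DepPred (k : ℕ) := ∀ M : Type, Set (Fin k → M) → Prop

/-- Closure under isomorphisms (part of the definition of a generalized
dependency). -/
def IsoClosed {k : ℕ} (D : DepPred k) : Prop :=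
  ∀ (M N : Type) (e : M ≃ N) (R : Set (Fin k → M)),
    D M R → D N ((fun f => e ∘ f) '' R)

/-- The complement `∼D` of a dependency. -/
def complD {k : ℕ} (D : DepPred k) : DepPred k := fun M R => ¬ D M R

def DownwardsClosed {k : ℕ} (D : DepPred k) : Prop :=
  ∀ (M : Type) (R R' : Set (Fin k → M)), D M R → R' ⊆ R → D M R'

/-- The downwards closure `D↓`. -/
def dClosure {k : ℕ} (D : DepPred k) : DepPred k :=
  fun M R => ∃ R', R ⊆ R' ∧ D M R'

/-- `D_max`: the maximal models of `D`. -/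
def DMax {k : ℕ} (D : DepPred k) : DepPred k :=
  fun M R => D M R ∧ ∀ R', R ⊂ R' → ¬ D M R'

/-- The empty team property. -/
def EmptyTeamProp {k : ℕ} (D : DepPred k) : Prop :=
  ∀ M : Type, Nontrivial M → D M (∅ : Set (Fin k → M))

/-- `D` is a first-order dependency: it is the class of models of a first-order
sentence over the signature `{R}`. -/
def FirstOrderDep {k : ℕ} (D : DepPred k) : Prop :=
  ∃ ψ : FOF (SigR k), IsSentence ψ ∧
    ∀ (M : Type), Nontrivial M → ∀ R : Set (Fin k → M),
      (D M R ↔ FOTrue M (interpR R) ψ)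

/-- The interpretation of a unary predicate symbol as a subset of the domain. -/
def PSet {S : Signature} {M : Type} (I : Interp S M) (P : S 1) : Set M :=
  {m | (fun _ => m) ∈ I 1 P}

/-- Semantics of the relativization `D^(P)` of `D` to the unary predicate `P`:
`𝔐 ⊨_X D^(P) x̄` iff `(P^𝔐, X(x̄)) ∈ D`. -/
def relSem {k : ℕ} (D : DepPred k) {S : Signature} (P : S 1)
    (M : Type) (I : Interp S M) (R : Set (Fin k → M)) : Prop :=
  (∀ f ∈ R, ∀ j, f j ∈ PSet I P) ∧
    D (↥(PSet I P)) {g : Fin k → ↥(PSet I P) | (fun j => (g j : M)) ∈ R}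

/-- A family `𝒟` of generalized dependencies is strongly first order: every
sentence of `FO(𝒟)` is equivalent to some first-order sentence. -/
def SFOFam {ι : Type} {ar : ι → ℕ} (D : ∀ i, DepPred (ar i)) : Prop :=
  ∀ (S : Signature) (φ : TS S ι ar), IsSentence φ → Plain φ →
    ∃ ψ : FOF S, IsSentence ψ ∧
      ∀ (M : Type), Nontrivial M → ∀ I : Interp S M,
        (TTrue M I (fun i => D i M) φ ↔ FOTrue M I ψ)

/-- A single dependency is strongly first order iff `{D}` is. -/
def SFOd {k : ℕ} (D : DepPred k) : Prop :=
  SFOFam (ι := Unit) (ar := fun _ => k) (fun _ => D)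

/-- A family `𝒟` is relativizable: every sentence of `FO(𝒟^(P))` is equivalent
to some sentence of `FO(𝒟)`. -/
def RelativizableFam {ι : Type} {ar : ι → ℕ} (D : ∀ i, DepPred (ar i)) : Prop :=
  ∀ (S : Signature) (P : S 1) (φ : TS S ι ar), IsSentence φ → Plain φ →
    ∃ ψ : TS S ι ar, IsSentence ψ ∧ Plain ψ ∧
      ∀ (M : Type), Nontrivial M → ∀ I : Interp S M,
        (TTrue M I (fun i => relSem (D i) P M I) φ ↔ TTrue M I (fun i => D i M) ψ)

def Relativizable1 {k : ℕ} (D : DepPred k) : Prop :=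
  RelativizableFam (ι := Unit) (ar := fun _ => k) (fun _ => D)

/-- The family `𝒟 ∪ ∼𝒟`. -/
def withComplFam {ι : Type} {ar : ι → ℕ} (D : ∀ i, DepPred (ar i)) :
    ∀ i : ι ⊕ ι, DepPred (Sum.elim ar ar i) :=
  fun i => match i with
    | .inl a => D a
    | .inr a => complD (D a)

/-- `D` is doubly strongly first order: `{D, ∼D}` is strongly first order. -/
def DSFOd {k : ℕ} (D : DepPred k) : Prop :=
  SFOFam (ι := Bool) (ar := fun _ => k)
    (fun b => match b with | true => D | false => complD D)

/-- The constancy atom of arity `k`. -/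
def constD (k : ℕ) : DepPred k := fun _ R => ∀ f ∈ R, ∀ g ∈ R, f = g

/-- The totality atom of arity `k`. -/
def allD (k : ℕ) : DepPred k := fun M R => R = (Set.univ : Set (Fin k → M))

/-- The family `𝒟 ∪ {const}` (constancy atoms of every arity). -/
def withConst {ι : Type} {ar : ι → ℕ} (D : ∀ i, DepPred (ar i)) :
    ∀ i : ι ⊕ ℕ, DepPred (Sum.elim ar id i) :=
  fun i => match i with
    | .inl a => D a
    | .inr n => constD n

/-- The atoms of `𝒟^(P) ∪ {const}`. -/
def withConstRel {ι : Type} {ar : ι → ℕ} (D : ∀ i, DepPred (ar i))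
    {S : Signature} (P : S 1) (M : Type) (I : Interp S M) :
    ∀ i : ι ⊕ ℕ, Set (Fin (Sum.elim ar id i) → M) → Prop :=
  fun i => match i with
    | .inl a => relSem (D a) P M I
    | .inr n => constD n M

/-- Atom indices of the logic `FO(𝒟₀, ⊔, const, All)`: the 0-ary first-order
dependencies `[ψ]`, the constancy atoms and the totality atoms. -/
inductive CIdx : Type
  | d0 (ψ : EF) (hψ : IsSentence ψ)
  | const (k : ℕ)
  | total (k : ℕ)

def cAr : CIdx → ℕ
  | .d0 _ _ => 0
  | .const k => k
  | .total k => k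

def cSem (M : Type) : ∀ i : CIdx, Set (Fin (cAr i) → M) → Prop
  | .d0 ψ _, _ => FOTrue M (eI M) ψ
  | .const _, R => ∀ f ∈ R, ∀ g ∈ R, f = g
  | .total _, R => R = Set.univ

/-- Embedding of first-order formulas over the empty signature into any
team logic. -/
def embedEF {S : Signature} {ι : Type} {ar : ι → ℕ} : EF → TS S ι ar
  | .rel r _ => Empty.elim r
  | .nrel r _ => Empty.elim r
  | .eq x y => .eq x y
  | .neq x y => .neq x y
  | .dep i _ => Empty.elim i
  | .and φ ψ => .and (embedEF φ) (embedEF ψ)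
  | .or φ ψ => .or (embedEF φ) (embedEF ψ)
  | .gdisj φ ψ => .gdisj (embedEF φ) (embedEF ψ)
  | .cneg φ => .cneg (embedEF φ)
  | .ex v φ => .ex v (embedEF φ)
  | .al v φ => .al v (embedEF φ)

/-- Override the values of the variables `0, …, k-1` by the tuple `f`. -/
def overrideFin {M : Type} (k : ℕ) (f : Fin k → M) (s : ℕ → M) : ℕ → M :=
  fun v => if h : v < k then f ⟨v, h⟩ else s v

/-- `(M, R) ⊨ ∃ȳ ∀x̄ (R x̄ → θ(x̄, ȳ))`, where `x̄` is the tuple of variables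
`0, …, k-1` and the remaining free variables `ȳ` of `θ` are witnessed by `s`. -/
def ExAllSem {k : ℕ} (M : Type) (R : Set (Fin k → M)) (θ : EF) : Prop :=
  ∃ s : ℕ → M, ∀ f ∈ R, FSat M (eI M) (overrideFin k f s) θ

/-- `(M, R) ⊨ ∃ȳ ∀x̄ (R x̄ ↔ θ(x̄, ȳ))`. -/
def ExAllIffSem {k : ℕ} (M : Type) (R : Set (Fin k → M)) (θ : EF) : Prop :=
  ∃ s : ℕ → M, ∀ f : Fin k → M, (f ∈ R ↔ FSat M (eI M) (overrideFin k f s) θ)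

/-- The assignment sending `x̄ = (0, …, k-1)` to `f`, `ȳ = (k, …, k+n-1)` to
`a`, and every other variable to its value under `s0`. -/
def tupAsg {M : Type} (k n : ℕ) (f : Fin k → M) (a : Fin n → M) (s0 : ℕ → M) :
    ℕ → M :=
  fun v => if h : v < k then f ⟨v, h⟩ else if h2 : v - k < n then a ⟨v - k, h2⟩ else s0 v

/-- `R` is defined by the formula `θ(x̄, ȳ)` (with `x̄ = (0, …, k-1)` and
`ȳ = (k, …, k+n-1)`): there is a tuple `ā` of parameters such that
`R = {m̄ : 𝔐 ⊨ θ(m̄, ā)}`. -/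
def DefinedBy {S : Signature} {M : Type} (I : Interp S M) (k n : ℕ)
    (θ : FOF S) (R : Set (Fin k → M)) : Prop :=
  ∃ a : Fin n → M, ∀ s0 : ℕ → M, R = {f | FSat M I (tupAsg k n f a s0) θ}

/-- `θ(x̄, ȳ)` fixes the identity type of `ȳ = (k, …, k+n-1)`. -/
def FixesIdType {S : Signature} (k n : ℕ) (θ : FOF S) : Prop :=
  ∀ i j : Fin n,
    (∀ (M : Type), Nontrivial M → ∀ (I : Interp S M) (s : ℕ → M),
        FSat M I s θ → s (k + (i : ℕ)) = s (k + (j : ℕ))) ∨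
    (∀ (M : Type), Nontrivial M → ∀ (I : Interp S M) (s : ℕ → M),
        FSat M I s θ → s (k + (i : ℕ)) ≠ s (k + (j : ℕ)))

/-- `(M, R := Xv) ⊨ ∃ȳ ∀x̄ (R x̄ → θ(x̄, ȳ))` where the `x̄`-slots of `θ` are the
variables `v̄` and the `ȳ`-slots are the variables `ȳ`. -/
def projExAll {M : Type} {k n : ℕ} (v : Fin k → ℕ) (y : Fin n → ℕ) (θ : EF)
    (Xv : Set (Fin k → M)) : Prop :=
  ∃ b : Fin n → M, ∀ f ∈ Xv, ∀ s : ℕ → M,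
    (∀ j, s (v j) = f j) → (∀ i, s (y i) = b i) → FSat M (eI M) s θ


/-- The equality type of a tuple: which of its entries coincide. -/
def eqType {α M : Type} (f : α → M) : α → α → Prop := fun a b => f a = f b

lemma eqType_comp_injective {α M N : Type} {π : M → N} (hπ : Function.Injective π) (f : α → M) :
    eqType (fun a => π (f a)) = eqType f := by
  funext a b
  exact propext hπ.eq_iff

lemma eqType_comp_eq {α β M N : Type} {f : α → M} {g : α → N} (h : eqType f = eqType g)
    (e : β → α) : eqType (fun b => f (e b)) = eqType (fun b => g (e b)) := by
  funext a b
  exact congrFun (congrFun h (e a)) (e b)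

lemma eqType_apply_iff {α M N : Type} {f : α → M} {g : α → N} (h : eqType f = eqType g)
    (a b : α) : f a = f b ↔ g a = g b :=
  iff_of_eq (congrFun (congrFun h a) b)

/-- Finite tuples with the same equality type are conjugate under a permutation. -/
lemma exists_perm_of_eqType {α M : Type} [Finite α] {y z : α → M} (h : eqType y = eqType z) :
    ∃ π : Equiv.Perm M, ∀ i, π (y i) = z i := by
  classical
  have key : ∀ s : Finset α, ∃ π : Equiv.Perm M, ∀ i ∈ s, π (y i) = z i := by
    intro s
    induction s using Finset.induction_on with
    | empty => exact ⟨1, by simp⟩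
    | insert a s _ ih =>
      obtain ⟨π, hπ⟩ := ih
      by_cases hex : ∃ i ∈ s, y i = y a
      · obtain ⟨i, hi, hia⟩ := hex
        refine ⟨π, fun j hj => ?_⟩
        rcases Finset.mem_insert.1 hj with rfl | hj
        · rw [← hia, hπ i hi]
          exact (eqType_apply_iff h _ _).1 hia
        · exact hπ j hj
      · refine ⟨Equiv.swap (π (y a)) (z a) * π, fun j hj => ?_⟩
        rcases Finset.mem_insert.1 hj with rfl | hj
        · simp
        · have hne : y j ≠ y a := fun he => hex ⟨j, hj, he⟩
          have hz : z j ≠ z a := fun he => hne ((eqType_apply_iff h _ _).2 he)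
          rw [Equiv.Perm.mul_apply, hπ j hj]
          refine Equiv.swap_apply_of_ne_of_ne (fun he => hne ?_) hz
          exact π.injective ((hπ j hj).trans he)
  have := Fintype.ofFinite α
  obtain ⟨π, hπ⟩ := key Finset.univ
  exact ⟨π, fun i => hπ i (Finset.mem_univ i)⟩

/-- The smallest relation containing `R` that is invariant under all permutations fixing `y`. -/
def hull {κ ν M : Type} (y : ν → M) (R : Set (κ → M)) : Set (κ → M) :=
  {x | ∃ x' ∈ R, eqType (Sum.elim x' y) = eqType (Sum.elim x y)}

lemma subset_hull {κ ν M : Type} (y : ν → M) (R : Set (κ → M)) : R ⊆ hull y R :=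
  fun x hx => ⟨x, hx, rfl⟩

lemma hull_subset_hull_comp {κ ν μ M : Type} (y : ν → M) (e : μ → ν) (R : Set (κ → M)) :
    hull y R ⊆ hull (fun i => y (e i)) R := by
  rintro x ⟨x', hx', h⟩
  refine ⟨x', hx', ?_⟩
  have := eqType_comp_eq h (Sum.map id e)
  have hh : ∀ w : κ → M, (fun b => Sum.elim w y (Sum.map id e b)) =
      Sum.elim w (fun i => y (e i)) := by
    intro w
    funext b
    cases b <;> rfl
  rwa [hh, hh] at this

/-- Finitely many colours on pairs of naturals admit a monochromatic triangle. -/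
lemma exists_monochromatic_triangle {C : Type} [Finite C] (c : ℕ → ℕ → C) :
    ∃ i j l, i < j ∧ j < l ∧ c i j = c i l ∧ c i j = c j l := by
  let U : Ultrafilter ℕ := Filter.hyperfilter ℕ
  have hgt : ∀ i, ∀ᶠ j in (U : Filter ℕ), i < j := fun i =>
    (Filter.hyperfilter_le_cofinite.trans Nat.cofinite_eq_atTop.le) (Filter.eventually_gt_atTop i)
  have hcol : ∀ d : ℕ → C, ∃ a, ∀ᶠ j in (U : Filter ℕ), d j = a := fun d => by
    have : ∀ᶠ j in (U : Filter ℕ), ∃ a, d j = a := Filter.Eventually.of_forall fun j => ⟨_, rfl⟩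
    exact Ultrafilter.eventually_exists_iff.1 this
  choose d hd using fun i => hcol (c i)
  obtain ⟨a, ha⟩ := hcol d
  obtain ⟨i, hi⟩ := ha.exists
  obtain ⟨j, ⟨hj, hij⟩, hcij⟩ := ((ha.and (hgt i)).and (hd i)).exists
  obtain ⟨l, ⟨hjl, hcil⟩, hcjl⟩ := (((hgt j).and (hd i)).and (hd j)).exists
  exact ⟨i, j, l, hij, hjl, hcij.trans hcil.symm, by rw [hcij, hcjl, hi, hj]⟩

/-- Relations supported by tuples of bounded length satisfy the ascending chain condition. -/
lemma not_strictMono_hull {κ ν M : Type} [Finite κ] [Finite ν] (y : ℕ → ν → M)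
    (Q : ℕ → Set (κ → M)) : ¬ StrictMono fun i => hull (y i) (Q i) := by
  intro hmono
  obtain ⟨i, j, l, hij, hjl, hil, hjl'⟩ := exists_monochromatic_triangle fun i j =>
    (eqType (Sum.elim (y i) (y j)),
      {p | ∃ x ∈ Q i, p = eqType (Sum.elim x (y i))},
      {p | ∃ x ∈ Q j, p = eqType (Sum.elim x (y j))})
  simp only [Prod.mk.injEq] at hil hjl'
  have mem : ∀ i x, x ∈ hull (y i) (Q i) ↔
      eqType (Sum.elim x (y i)) ∈ {p | ∃ x ∈ Q i, p = eqType (Sum.elim x (y i))} := by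
    intro i x
    constructor
    · rintro ⟨x', hx', h⟩
      exact ⟨x', hx', h.symm⟩
    · rintro ⟨x', hx', h⟩
      exact ⟨x', hx', h.symm⟩
  have hself : ∀ a b, y i a = y i b ↔ y j a = y j b := fun a b =>
    eqType_apply_iff hjl'.1 (Sum.inl a) (Sum.inl b)
  have hcross : ∀ a b, y i a = y j b → y i a = y j a := by
    intro a b hab
    have h1 : y i a = y l b := (eqType_apply_iff hil.1 (Sum.inl a) (Sum.inr b)).1 hab
    have h2 : y j a = y l b := (eqType_apply_iff hjl'.1 (Sum.inl a) (Sum.inr b)).1 hab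
    exact h1.trans h2.symm
  have hswap : ∀ a b, y i a = y j b → y i b = y j a := by
    intro a b hab
    have h1 := hcross a b hab
    have h2 : y j a = y j b := h1.symm.trans hab
    rw [← h1]
    exact ((hself a b).2 h2).symm
  have hsymm : eqType (Sum.elim (y i) (y j)) = eqType (Sum.elim (y j) (y i)) := by
    funext a b
    apply propext
    rcases a with a | a <;> rcases b with b | b
    · exact hself a b
    · exact ⟨fun h => (hswap a b h).symm, fun h => (hswap b a h.symm)⟩
    · exact ⟨fun h => (hswap b a h.symm), fun h => (hswap a b h).symm⟩
    · exact (hself a b).symm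
  obtain ⟨π, hπ⟩ := exists_perm_of_eqType hsymm
  have hπi : ∀ a, π (y i a) = y j a := fun a => hπ (Sum.inl a)
  have hπj : ∀ a, π (y j a) = y i a := fun a => hπ (Sum.inr a)
  have elim_comp : ∀ (x : κ → M) (z w : ν → M), (∀ a, π (z a) = w a) →
      eqType (Sum.elim (fun t => π (x t)) w) = eqType (Sum.elim x z) := by
    intro x z w hzw
    rw [← eqType_comp_injective π.injective (Sum.elim x z)]
    congr 1
    funext b
    rcases b with b | b
    · rfl
    · exact (hzw b).symm
  have hT := hjl'.2.1
  obtain ⟨hsub, x, hxj, hxi⟩ := Set.ssubset_iff_exists.1 (hmono hij)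
  apply hxi
  have h1 : (fun t => π (x t)) ∈ hull (y i) (Q i) := by
    rw [mem, elim_comp x _ _ hπj, hT, ← mem]
    exact hxj
  have h2 := hsub h1
  rw [mem, elim_comp x _ _ hπi, ← hT, ← mem] at h2
  exact h2

/-- A finite set of points together with a permutation, viewed as the finite partial injection
obtained by restriction. -/
structure FinPerm (N : Type) where
  dom : Finset N
  perm : Equiv.Perm N

instance (N : Type) : Preorder (FinPerm N) where
  le p q := p.dom ⊆ q.dom ∧ ∀ x ∈ p.dom, p.perm x = q.perm x
  le_refl p := ⟨Finset.Subset.refl _, fun _ _ => rfl⟩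
  le_trans p q r hpq hqr := ⟨hpq.1.trans hqr.1, fun x hx =>
    (hpq.2 x hx).trans (hqr.2 x (hpq.1 hx))⟩

/-- An ideal of finite partial injections meeting all the obvious dense sets is a permutation. -/
lemma exists_perm_of_ideal {N : Type} (J : Order.Ideal (FinPerm N))
    (hdom : ∀ x, ∃ p ∈ J, x ∈ p.dom) (hran : ∀ y, ∃ p ∈ J, ∃ x ∈ p.dom, p.perm x = y) :
    ∃ π : Equiv.Perm N, ∀ p ∈ J, ∀ x ∈ p.dom, π x = p.perm x := by
  choose P hP hPx using hdom
  have agree : ∀ p ∈ J, ∀ x ∈ p.dom, (P x).perm x = p.perm x := by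
    intro p hp x hx
    obtain ⟨q, _, h1, h2⟩ := J.directed _ (hP x) _ hp
    exact (h1.2 x (hPx x)).trans (h2.2 x hx).symm
  have hbij : Function.Bijective fun x => (P x).perm x := by
    constructor
    · intro x x' h
      obtain ⟨q, _, h1, h2⟩ := J.directed _ (hP x) _ (hP x')
      apply q.perm.injective
      rw [← h1.2 x (hPx x), ← h2.2 x' (hPx x')]
      exact h
    · intro y
      obtain ⟨p, hp, x, hx, hxy⟩ := hran y
      exact ⟨x, (agree p hp x hx).trans hxy⟩
  exact ⟨Equiv.ofBijective _ hbij, agree⟩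

/-- If no finite condition forces an image of `R` into some `E b`, then a generic permutation
moves `R` outside of all of the countably many `E b`. -/
lemma exists_perm_image_not_subset {κ N B : Type} [Finite κ] [Countable N] [Countable B]
    (R : Set (κ → N)) (E : B → Set (κ → N))
    (h : ∀ (b : B) (m : ℕ) (y z : Fin m → N), eqType y = eqType z →
      ∃ x x', x' ∈ R ∧ x ∉ E b ∧ eqType (Sum.elim x' y) = eqType (Sum.elim x z)) :
    ∃ π : Equiv.Perm N, ∀ b, ∃ x ∈ R, (fun t => π (x t)) ∉ E b := by
  classical
  have := Fintype.ofFinite κ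
  have := Encodable.ofCountable N
  have := Encodable.ofCountable B
  let 𝒟 : N ⊕ N ⊕ B → Order.Cofinal (FinPerm N) := fun i => match i with
    | .inl x => ⟨{p | x ∈ p.dom}, fun p => ⟨⟨insert x p.dom, p.perm⟩, by simp,
        Finset.subset_insert _ _, fun _ _ => rfl⟩⟩
    | .inr (.inl y) => ⟨{p | ∃ x ∈ p.dom, p.perm x = y}, fun p =>
        ⟨⟨insert (p.perm.symm y) p.dom, p.perm⟩, ⟨p.perm.symm y, by simp, by simp⟩,
          Finset.subset_insert _ _, fun _ _ => rfl⟩⟩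
    | .inr (.inr b) => ⟨{p | ∃ x ∈ R, (∀ t, x t ∈ p.dom) ∧ (fun t => p.perm (x t)) ∉ E b}, by
        intro p
        let y : Fin p.dom.card → N := fun i => p.dom.equivFin.symm i
        obtain ⟨x, x', hx', hx, hxx⟩ := h b p.dom.card y (fun i => p.perm (y i))
          (eqType_comp_injective p.perm.injective y).symm
        obtain ⟨σ, hσ⟩ := exists_perm_of_eqType hxx
        refine ⟨⟨p.dom ∪ Finset.univ.image x', σ⟩, ⟨x', hx', fun t => ?_, ?_⟩,
          Finset.subset_union_left, fun a ha => ?_⟩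
        · exact Finset.mem_union_right _ (Finset.mem_image_of_mem _ (Finset.mem_univ t))
        · have : (fun t => σ (x' t)) = x := funext fun t => hσ (Sum.inl t)
          simpa [this] using hx
        · have := hσ (Sum.inr (p.dom.equivFin ⟨a, ha⟩))
          simpa [y] using this.symm⟩
  let J := Order.idealOfCofinals (⟨∅, 1⟩ : FinPerm N) 𝒟
  have hJ := Order.cofinal_meets_idealOfCofinals (⟨∅, 1⟩ : FinPerm N) 𝒟
  obtain ⟨π, hπ⟩ := exists_perm_of_ideal J
    (fun x => by obtain ⟨p, h1, h2⟩ := hJ (.inl x); exact ⟨p, h2, h1⟩)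
    (fun y => by obtain ⟨p, h1, h2⟩ := hJ (.inr (.inl y)); exact ⟨p, h2, h1⟩)
  refine ⟨π, fun b => ?_⟩
  obtain ⟨p, ⟨x, hx, hxd, hxE⟩, hp⟩ := hJ (.inr (.inr b))
  refine ⟨x, hx, ?_⟩
  rwa [funext fun t => hπ p hp (x t) (hxd t)]

section ModelTheory

open FirstOrder Filter

/-- A relational signature as a first-order language. -/
abbrev lang (S : Signature) : Language := ⟨fun _ => Empty, S⟩

/-- The first-order structure given by an interpretation. -/
abbrev structOf {S : Signature} {M : Type} (I : Interp S M) : (lang S).Structure M where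
  funMap := fun f => f.elim
  RelMap := fun {n} r v => v ∈ I n r

/-- The interpretation given by a first-order structure. -/
def interpOf {S : Signature} (M : Type) [(lang S).Structure M] : Interp S M :=
  fun n r => {v | Language.Structure.RelMap (L := lang S) (n := n) r v}

/-- The atomic formula `r(v)` in the language of `S`. -/
def relFormula {S : Signature} {α : Type} {n : ℕ} (r : S n) (v : Fin n → α) :
    (lang S).Formula α :=
  Language.Relations.formula (L := lang S) r fun i => Language.Term.var (v i)

lemma realize_relFormula {S : Signature} {α : Type} {n : ℕ} (r : S n) (v : Fin n → α)
    {M : Type} [(lang S).Structure M] (s : α → M) :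
    (relFormula r v).Realize s ↔ (fun i => s (v i)) ∈ interpOf M n r := by
  rw [relFormula, Language.Formula.realize_rel]
  rfl

/-- The atomic formula `x = y` in the language of `S`. -/
def eqFormula {S : Signature} {α : Type} (x y : α) : (lang S).Formula α :=
  Language.Term.equal (Language.Term.var x) (Language.Term.var y)

lemma realize_eqFormula {S : Signature} {α : Type} (x y : α)
    {M : Type} [(lang S).Structure M] (s : α → M) :
    (eqFormula x y : (lang S).Formula α).Realize s ↔ s x = s y := by
  rw [eqFormula, Language.Formula.realize_equal]
  rfl

/-- Turn the free variable `v` into a bound variable. -/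
def bindVar {S : Signature} (v : ℕ) (φ : (lang S).Formula ℕ) : (lang S).BoundedFormula ℕ 1 :=
  Language.BoundedFormula.relabel (n := 1)
    (fun n => if n = v then Sum.inr 0 else Sum.inl n) φ

lemma realize_bindVar {S : Signature} {M : Type} [(lang S).Structure M]
    (φ : (lang S).Formula ℕ) (v : ℕ) (s : ℕ → M) (xs : Fin 1 → M) :
    (bindVar v φ).Realize s xs ↔ φ.Realize (Function.update s v (xs 0)) := by
  rw [bindVar, Language.BoundedFormula.realize_relabel, Language.Formula.Realize]
  apply iff_of_eq
  congr 1
  · funext n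
    by_cases h : n = v <;> simp [h]
  · exact Subsingleton.elim _ _

/-- Every first-order formula translates to a formula of the corresponding language. -/
lemma exists_formula {S : Signature} (φ : FOF S) :
    ∃ φ' : (lang S).Formula ℕ, ∀ (M : Type) [(lang S).Structure M] (s : ℕ → M),
      φ'.Realize s ↔ FSat M (interpOf M) s φ := by
  induction φ with
  | rel r v => exact ⟨relFormula r v, fun M _ s => realize_relFormula r v s⟩
  | nrel r v =>
    refine ⟨(relFormula r v).not, fun M _ s => ?_⟩
    rw [Language.Formula.realize_not, realize_relFormula]
    rfl
  | eq x y => exact ⟨eqFormula x y, fun M _ s => realize_eqFormula x y s⟩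
  | neq x y =>
    refine ⟨(eqFormula x y).not, fun M _ s => ?_⟩
    rw [Language.Formula.realize_not, realize_eqFormula]
    rfl
  | dep i v => exact i.elim
  | and φ ψ ihφ ihψ =>
    obtain ⟨φ', hφ⟩ := ihφ
    obtain ⟨ψ', hψ⟩ := ihψ
    exact ⟨φ' ⊓ ψ', fun M _ s => by rw [Language.Formula.realize_inf, hφ, hψ]; rfl⟩
  | or φ ψ ihφ ihψ =>
    obtain ⟨φ', hφ⟩ := ihφ
    obtain ⟨ψ', hψ⟩ := ihψ
    exact ⟨φ' ⊔ ψ', fun M _ s => by rw [Language.Formula.realize_sup, hφ, hψ]; rfl⟩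
  | gdisj φ ψ ihφ ihψ =>
    obtain ⟨φ', hφ⟩ := ihφ
    obtain ⟨ψ', hψ⟩ := ihψ
    exact ⟨φ' ⊔ ψ', fun M _ s => by rw [Language.Formula.realize_sup, hφ, hψ]; rfl⟩
  | cneg φ ih =>
    obtain ⟨φ', hφ⟩ := ih
    exact ⟨φ'.not, fun M _ s => by rw [Language.Formula.realize_not, hφ]; rfl⟩
  | ex v φ ih =>
    obtain ⟨φ', hφ⟩ := ih
    refine ⟨Language.BoundedFormula.ex (bindVar v φ'), fun M _ s => ?_⟩
    rw [Language.Formula.Realize, Language.BoundedFormula.realize_ex]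
    refine exists_congr fun m => ?_
    rw [realize_bindVar, hφ]
    rfl
  | al v φ ih =>
    obtain ⟨φ', hφ⟩ := ih
    refine ⟨Language.BoundedFormula.all (bindVar v φ'), fun M _ s => ?_⟩
    rw [Language.Formula.Realize, Language.BoundedFormula.realize_all]
    refine forall_congr' fun m => ?_
    rw [realize_bindVar, hφ]
    rfl

/-- Satisfaction depends only on the values of the free variables. -/
lemma FSat_congr {S : Signature} {ι : Type} {ar : ι → ℕ} {M : Type} (I : Interp S M)
    (φ : TS S ι ar) : ∀ {s t : ℕ → M}, (∀ v ∈ fv φ, s v = t v) →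
      (FSat M I s φ ↔ FSat M I t φ) := by
  induction φ with
  | rel r v | nrel r v =>
    intro s t h
    have : (fun i => s (v i)) = fun i => t (v i) := funext fun i => h _ ⟨i, rfl⟩
    simp only [FSat, this]
  | eq x y | neq x y =>
    intro s t h
    simp only [FSat, h x (Or.inl rfl), h y (Or.inr rfl)]
  | dep i v => exact fun _ => Iff.rfl
  | and φ ψ ihφ ihψ =>
    exact fun h => and_congr (ihφ fun v hv => h v (Or.inl hv)) (ihψ fun v hv => h v (Or.inr hv))
  | or φ ψ ihφ ihψ | gdisj φ ψ ihφ ihψ =>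
    exact fun h => or_congr (ihφ fun v hv => h v (Or.inl hv)) (ihψ fun v hv => h v (Or.inr hv))
  | cneg φ ih => exact fun h => not_congr (ih h)
  | ex v φ ih =>
    intro s t h
    refine exists_congr fun m => ih fun w hw => ?_
    by_cases hv : w = v
    · simp [hv]
    · simp [hv, h w ⟨hw, hv⟩]
  | al v φ ih =>
    intro s t h
    refine forall_congr' fun m => ih fun w hw => ?_
    by_cases hv : w = v
    · simp [hv]
    · simp [hv, h w ⟨hw, hv⟩]

/-- Every first-order sentence translates to a sentence of the corresponding language. -/
lemma exists_sentence {S : Signature} (ψ : FOF S) (hψ : IsSentence ψ) :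
    ∃ σ : (lang S).Sentence, ∀ (M : Type) [Nonempty M] [(lang S).Structure M],
      M ⊨ σ ↔ FOTrue M (interpOf M) ψ := by
  obtain ⟨φ, hφ⟩ := exists_formula ψ
  refine ⟨(φ.relabel (fun _ : ℕ => (Sum.inr () : Empty ⊕ Unit))).iAlls Unit, fun M _ _ => ?_⟩
  rw [Language.Sentence.Realize, Language.Formula.realize_iAlls]
  simp only [Language.Formula.realize_relabel, hφ]
  have hind : ∀ s t : ℕ → M, FSat M (interpOf M) s ψ ↔ FSat M (interpOf M) t ψ := fun s t =>
    FSat_congr _ ψ fun v hv => by rw [hψ] at hv; exact hv.elim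
  constructor
  · intro h s
    exact (hind _ _).1 (h fun _ => s 0)
  · intro h i
    exact h _

/-- A sequence of infinite structures in a countable language has a countable infinite limit
satisfying every sentence that holds eventually. -/
lemma exists_countable_limit (L : Language) [Countable L.Symbols] (A : ℕ → Type)
    [∀ n, Infinite (A n)] [∀ n, L.Structure (A n)] :
    ∃ (B : Type) (_ : L.Structure B), Countable B ∧ Infinite B ∧
      ∀ σ : L.Sentence, (∀ᶠ n in atTop, A n ⊨ σ) → B ⊨ σ := by
  let T : L.Theory := {σ | ∀ᶠ n in atTop, A n ⊨ σ}
  have hT : T.IsSatisfiable := by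
    rw [Language.Theory.isSatisfiable_iff_isFinitelySatisfiable]
    intro T₀ hT₀
    have : ∀ᶠ n in atTop, ∀ σ ∈ T₀, A n ⊨ σ :=
      (Filter.eventually_all_finset T₀).2 fun σ hσ => hT₀ hσ
    obtain ⟨n, hn⟩ := this.exists
    have : A n ⊨ (T₀ : L.Theory) := ⟨fun σ hσ => hn σ hσ⟩
    exact Language.Theory.Model.isSatisfiable (A n)
  obtain ⟨X⟩ := hT
  have hinf : Infinite X := by
    rw [← Language.model_infiniteTheory_iff (L := L)]
    refine Language.Theory.Model.mono X.is_model ?_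
    intro σ hσ
    exact Eventually.of_forall fun n =>
      (Language.model_infiniteTheory L (M := A n)).realize_of_mem σ hσ
  obtain ⟨B, hB⟩ := Language.Theory.exists_model_card_eq ⟨X, hinf⟩ Cardinal.aleph0.{0} le_rfl
    (by simpa [Language.card] using Cardinal.mk_le_aleph0 (α := L.Symbols))
  exact ⟨B, inferInstance, Cardinal.mk_le_aleph0_iff.1 hB.le, Cardinal.infinite_iff.2 hB.ge,
    fun σ hσ => B.is_model.realize_of_mem σ hσ⟩

end ModelTheory

section TeamSentences

/-- Iterated universal quantification over a list of variables. -/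
def als {S : Signature} {ι : Type} {ar : ι → ℕ} (l : List ℕ) (φ : TS S ι ar) : TS S ι ar :=
  l.foldr TS.al φ

lemma fv_als {S : Signature} {ι : Type} {ar : ι → ℕ} (l : List ℕ) (φ : TS S ι ar) :
    fv (als l φ) = fv φ \ {v | v ∈ l} := by
  induction l with
  | nil => simp [als]
  | cons a l ih =>
    change fv (als l φ) \ {a} = _
    rw [ih]
    ext v
    simp only [Set.mem_sdiff, Set.mem_ofPred_eq, Set.mem_singleton_iff, List.mem_cons]
    tauto

lemma fv_exs {S : Signature} {ι : Type} {ar : ι → ℕ} (l : List ℕ) (φ : TS S ι ar) :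
    fv (exs l φ) = fv φ \ {v | v ∈ l} := by
  induction l with
  | nil => simp [exs]
  | cons a l ih =>
    change fv (exs l φ) \ {a} = _
    rw [ih]
    ext v
    simp only [Set.mem_sdiff, Set.mem_ofPred_eq, Set.mem_singleton_iff, List.mem_cons]
    tauto

lemma plain_als {S : Signature} {ι : Type} {ar : ι → ℕ} (l : List ℕ) (φ : TS S ι ar) :
    Plain (als l φ) ↔ Plain φ := by
  induction l with
  | nil => rfl
  | cons a l ih => exact ih

lemma plain_exs {S : Signature} {ι : Type} {ar : ι → ℕ} (l : List ℕ) (φ : TS S ι ar) :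
    Plain (exs l φ) ↔ Plain φ := by
  induction l with
  | nil => rfl
  | cons a l ih => exact ih

lemma TSat_als_univ {S : Signature} {ι : Type} {ar : ι → ℕ} {M : Type} (I : Interp S M)
    (A : ∀ i, Set (Fin (ar i) → M) → Prop) (l : List ℕ) (φ : TS S ι ar) :
    TSat M I A (als l φ) Set.univ ↔ TSat M I A φ Set.univ := by
  induction l with
  | nil => rfl
  | cons a l ih =>
    have : {s' : ℕ → M | ∃ s ∈ Set.univ, ∃ m : M, s' = Function.update s a m} = Set.univ :=
      Set.eq_univ_of_forall fun s => ⟨s, Set.mem_univ s, s a, (Function.update_eq_self a s).symm⟩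
    change TSat M I A (als l φ) _ ↔ _
    rw [this, ih]

/-- Iterated existential quantification chooses a team extending the given one. -/
lemma TSat_exs {S : Signature} {ι : Type} {ar : ι → ℕ} {M : Type} (I : Interp S M)
    (A : ∀ i, Set (Fin (ar i) → M) → Prop) (l : List ℕ) (φ : TS S ι ar) :
    ∀ X : Set (ℕ → M), TSat M I A (exs l φ) X ↔ ∃ Y, TSat M I A φ Y ∧
      (∀ s ∈ X, ∃ s' ∈ Y, ∀ v ∉ l, s' v = s v) ∧ (∀ s' ∈ Y, ∃ s ∈ X, ∀ v ∉ l, s' v = s v) := by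
  induction l with
  | nil =>
    intro X
    constructor
    · intro h
      exact ⟨X, h, fun s hs => ⟨s, hs, fun _ _ => rfl⟩, fun s hs => ⟨s, hs, fun _ _ => rfl⟩⟩
    · rintro ⟨Y, hY, h1, h2⟩
      have : X = Y := by
        ext s
        constructor
        · intro hs
          obtain ⟨s', hs', h⟩ := h1 s hs
          rwa [← (funext fun v => h v (by simp) : s' = s)]
        · intro hs
          obtain ⟨s', hs', h⟩ := h2 s hs
          rwa [(funext fun v => h v (by simp) : s = s')]
      rw [this]
      exact hY
  | cons a l ih =>
    intro X
    constructor
    · rintro ⟨H, hH, hsat⟩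
      obtain ⟨Y, hY, h1, h2⟩ := (ih _).1 hsat
      refine ⟨Y, hY, fun s hs => ?_, fun s' hs' => ?_⟩
      · obtain ⟨m, hm⟩ := hH s hs
        obtain ⟨s', hs', h⟩ := h1 _ ⟨s, hs, m, hm, rfl⟩
        refine ⟨s', hs', fun v hv => ?_⟩
        rw [List.mem_cons, not_or] at hv
        rw [h v hv.2, Function.update_of_ne hv.1]
      · obtain ⟨_, ⟨s, hs, m, _, rfl⟩, h⟩ := h2 s' hs'
        refine ⟨s, hs, fun v hv => ?_⟩
        rw [List.mem_cons, not_or] at hv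
        rw [h v hv.2, Function.update_of_ne hv.1]
    · rintro ⟨Y, hY, h1, h2⟩
      have agree : ∀ s s' : ℕ → M, (∀ v ∉ a :: l, s' v = s v) →
          ∀ v ∉ l, s' v = Function.update s a (s' a) v := by
        intro s s' h v hv
        by_cases hva : v = a
        · simp [hva]
        · rw [Function.update_of_ne hva]
          exact h v (by simp [hva, hv])
      refine ⟨fun s => {m | ∃ s' ∈ Y, (∀ v ∉ a :: l, s' v = s v) ∧ s' a = m}, fun s hs => ?_,
        (ih _).2 ⟨Y, hY, ?_, fun s' hs' => ?_⟩⟩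
      · obtain ⟨s', hs', h⟩ := h1 s hs
        exact ⟨s' a, s', hs', h, rfl⟩
      · rintro _ ⟨s, hs, _, ⟨s', hs', h, rfl⟩, rfl⟩
        exact ⟨s', hs', agree s s' h⟩
      · obtain ⟨s, hs, h⟩ := h2 s' hs'
        exact ⟨_, ⟨s, hs, s' a, ⟨s', hs', h, rfl⟩, rfl⟩, agree _ _ h⟩

/-- Relation symbols for a set, a `k`-ary relation, and a family of `k`-ary relations. -/
inductive FamilySym (k : ℕ) : ℕ → Type
  | dom : FamilySym k 1
  | base : FamilySym k k
  | mem : FamilySym k (k + 1)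

instance (k : ℕ) : Countable (lang (FamilySym k)).Symbols := by
  have hF : Countable (Σ n, FamilySym k n) := by
    let f : Fin 3 → Σ n, FamilySym k n := ![⟨1, .dom⟩, ⟨k, .base⟩, ⟨k + 1, .mem⟩]
    have hf : Function.Surjective f := by
      rintro ⟨n, r⟩
      cases r with
      | dom => exact ⟨0, rfl⟩
      | base => exact ⟨1, rfl⟩
      | mem => exact ⟨2, rfl⟩
    exact hf.countable
  have hE : Countable (Σ _ : ℕ, Empty) := inferInstance
  exact @instCountableSum _ _ hE hF

/-- The team sentence stating that the base relation satisfies the dependency. -/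
def baseSentence (k : ℕ) : TS (FamilySym k) Unit (fun _ => k) :=
  als (List.range k) (.or (.nrel .base Fin.val) (.and (.rel .base Fin.val) (.dep () Fin.val)))

/-- The team sentence stating that some relation satisfying the dependency is not included in
any member of the family. -/
def escapeSentence (k : ℕ) : TS (FamilySym k) Unit (fun _ => k) :=
  als [k, k + 1, k + 2] (exs (List.range k)
    (.and (.or (.neq (k + 1) (k + 2)) (.nrel .mem (Fin.cons k Fin.val))) (.dep () Fin.val)))

lemma baseSentence_isSentence (k : ℕ) : IsSentence (baseSentence k) := by
  rw [IsSentence, baseSentence, fv_als, Set.sdiff_eq_empty]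
  simp only [fv, Set.union_self]
  rintro _ ⟨i, rfl⟩
  simp

lemma escapeSentence_isSentence (k : ℕ) : IsSentence (escapeSentence k) := by
  rw [IsSentence, escapeSentence, fv_als, fv_exs, Set.sdiff_eq_empty, Set.sdiff_subset_iff]
  simp only [fv]
  rintro v ((h | ⟨i, rfl⟩) | ⟨i, rfl⟩)
  · right
    rcases h with rfl | rfl <;> simp
  · induction i using Fin.cases with
    | zero => simp
    | succ i => simp
  · simp

lemma baseSentence_plain (k : ℕ) : Plain (baseSentence k) := by
  rw [baseSentence, plain_als]
  simp [Plain, NoCneg, NoGdisj]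

lemma escapeSentence_plain (k : ℕ) : Plain (escapeSentence k) := by
  rw [escapeSentence, plain_als, plain_exs]
  simp [Plain, NoCneg, NoGdisj]

lemma overrideFin_val {M : Type} {k : ℕ} (f : Fin k → M) (s : ℕ → M) (i : Fin k) :
    overrideFin k f s i = f i := by
  simp [overrideFin]

lemma overrideFin_of_le {M : Type} {k v : ℕ} (f : Fin k → M) (s : ℕ → M) (h : k ≤ v) :
    overrideFin k f s v = s v := by
  simp [overrideFin, h]

lemma TTrue_baseSentence {k : ℕ} {M : Type} [Nonempty M] (I : Interp (FamilySym k) M)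
    (A : Unit → Set (Fin k → M) → Prop) :
    TTrue M I A (baseSentence k) ↔ A () (I k .base) := by
  obtain ⟨m⟩ := ‹Nonempty M›
  rw [TTrue, baseSentence, TSat_als_univ]
  have hproj : ∀ Z : Set (ℕ → M), (∀ s, s ∈ Z ↔ (fun i : Fin k => s i) ∈ I k .base) →
      teamProj Fin.val Z = I k .base := by
    intro Z hZ
    ext f
    constructor
    · rintro ⟨s, hs, rfl⟩
      exact (hZ s).1 hs
    · intro hf
      have he : (fun i : Fin k => overrideFin k f (fun _ => m) i) = f :=
        funext fun i => overrideFin_val f _ i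
      exact ⟨overrideFin k f fun _ => m, (hZ _).2 (by rwa [he]), he.symm⟩
  constructor
  · rintro ⟨Y, Z, hYZ, hY, hZ, hA⟩
    rw [← hproj Z fun s => ⟨hZ s, fun hs => ?_⟩]
    · exact hA
    · have : s ∈ Y ∪ Z := hYZ ▸ Set.mem_univ s
      exact this.resolve_left fun h => hY s h hs
  · intro hA
    refine ⟨{s | (fun i : Fin k => s i) ∉ I k .base}, {s | (fun i : Fin k => s i) ∈ I k .base},
      ?_, fun s hs => hs, fun s hs => hs, ?_⟩
    · ext s
      simp only [Set.mem_union, Set.mem_ofPred_eq, Set.mem_univ, iff_true]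
      exact (em _).symm
    · change A () (teamProj Fin.val _)
      rw [hproj {s | (fun i : Fin k => s i) ∈ I k .base} fun s => Iff.rfl]
      exact hA

lemma TTrue_escapeSentence {k : ℕ} {M : Type} [Nontrivial M] (I : Interp (FamilySym k) M)
    (A : Unit → Set (Fin k → M) → Prop) :
    TTrue M I A (escapeSentence k) ↔
      ∃ Q, A () Q ∧ ∀ b, ∃ x ∈ Q, (Fin.cons b x : Fin (k + 1) → M) ∉ I (k + 1) .mem := by
  obtain ⟨m, m', hm⟩ := exists_pair_ne M
  rw [TTrue, escapeSentence, TSat_als_univ, TSat_exs]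
  have hcons : ∀ s : ℕ → M, (fun i : Fin (k + 1) => s ((Fin.cons k Fin.val : Fin (k + 1) → ℕ) i)) =
      Fin.cons (s k) (fun i : Fin k => s i) := by
    intro s
    funext i
    induction i using Fin.cases <;> simp
  constructor
  · rintro ⟨Y, ⟨⟨Y₁, Y₂, hY, h1, h2⟩, hA⟩, hext, -⟩
    refine ⟨teamProj Fin.val Y, hA, fun b => ?_⟩
    obtain ⟨s, hs, hsv⟩ := hext (fun _ => b) (Set.mem_univ _)
    refine ⟨_, ⟨s, hs, rfl⟩, ?_⟩
    have hsv' : ∀ v, k ≤ v → s v = b := fun v hv => hsv v (by simpa using hv)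
    have hs2 : s ∈ Y₂ := by
      rw [← hY] at hs
      exact hs.resolve_left fun h => h1 s h (by rw [hsv' _ (by lia), hsv' _ (by lia)])
    have := h2 s hs2
    rwa [hcons, hsv' k le_rfl] at this
  · rintro ⟨Q, hA, hQ⟩
    let Y₁ : Set (ℕ → M) := {s | (fun i : Fin k => s i) ∈ Q ∧ s (k + 1) ≠ s (k + 2)}
    let Y₂ : Set (ℕ → M) := {s | (fun i : Fin k => s i) ∈ Q ∧
      (Fin.cons (s k) (fun i : Fin k => s i) : Fin (k + 1) → M) ∉ I (k + 1) .mem}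
    have he : ∀ (x : Fin k → M) s, (fun i : Fin k => overrideFin k x s i) = x :=
      fun x s => funext fun i => overrideFin_val x s i
    refine ⟨Y₁ ∪ Y₂, ⟨⟨Y₁, Y₂, rfl, fun s hs => hs.2, fun s hs => ?_⟩, ?_⟩, fun s _ => ?_,
      fun s _ => ⟨s, Set.mem_univ s, fun _ _ => rfl⟩⟩
    · rw [hcons]
      exact hs.2
    · have : teamProj Fin.val (Y₁ ∪ Y₂) = Q := by
        ext x
        constructor
        · rintro ⟨s, hs | hs, rfl⟩
          · exact hs.1
          · exact hs.1
        · intro hx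
          refine ⟨overrideFin k x fun v => if v = k + 1 then m else m', Or.inl ⟨?_, ?_⟩,
            (he x _).symm⟩
          · rwa [he]
          · rw [overrideFin_of_le _ _ (by lia), overrideFin_of_le _ _ (by lia)]
            simpa using hm
      change A () (teamProj Fin.val _)
      rwa [this]
    · obtain ⟨x, hx, hxb⟩ := hQ (s k)
      refine ⟨overrideFin k x s, Or.inr ⟨?_, ?_⟩, fun v hv => ?_⟩
      · rwa [he]
      · rwa [he, overrideFin_of_le _ _ le_rfl]
      · exact overrideFin_of_le _ _ (by simpa using hv)

end TeamSentences


section UniformBound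

open FirstOrder Filter

/-- No member of the family contains the image, under a permutation of the unary predicate, of the
hull of the base relation over `m` parameters. -/
def Spreads {k : ℕ} (m : ℕ) {A : Type} (I : Interp (FamilySym k) A) : Prop :=
  ∀ (b : A) (y z : Fin m → A), (∀ i, y i ∈ PSet I .dom) → (∀ i, z i ∈ PSet I .dom) →
    eqType y = eqType z → ∃ x x' : Fin k → A, (∀ i, x i ∈ PSet I .dom) ∧
      (∀ i, x' i ∈ PSet I .dom) ∧ x' ∈ I k .base ∧
      (Fin.cons b x : Fin (k + 1) → A) ∉ I (k + 1) .mem ∧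
      eqType (Sum.elim x' y) = eqType (Sum.elim x z)

/-- The formula stating that two tuples of variables have the same equality type. -/
noncomputable def eqTypeFormula {S : Signature} {α γ : Type} [Finite α] (f g : α → γ) :
    (lang S).Formula γ :=
  Language.Formula.iInf fun p : α × α =>
    (eqFormula (f p.1) (f p.2)).iff (eqFormula (g p.1) (g p.2))

lemma realize_eqTypeFormula {S : Signature} {α γ : Type} [Finite α] (f g : α → γ)
    {M : Type} [(lang S).Structure M] (s : γ → M) :
    (eqTypeFormula f g : (lang S).Formula γ).Realize s ↔
      eqType (fun a => s (f a)) = eqType (fun a => s (g a)) := by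
  rw [eqTypeFormula, Language.Formula.realize_iInf]
  simp only [Language.Formula.realize_iff, realize_eqFormula, Prod.forall]
  constructor
  · intro h
    funext a b
    exact propext (h a b)
  · intro h a b
    exact eqType_apply_iff h a b

/-- The formula stating that all entries of a tuple of variables lie in the unary predicate. -/
noncomputable def allRelFormula {S : Signature} {α γ : Type} [Finite α] (P : S 1) (f : α → γ) :
    (lang S).Formula γ :=
  Language.Formula.iInf fun a => relFormula P fun _ => f a

lemma realize_allRelFormula {S : Signature} {α γ : Type} [Finite α] (P : S 1) (f : α → γ)
    {M : Type} [(lang S).Structure M] (s : γ → M) :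
    (allRelFormula P f).Realize s ↔ ∀ a, s (f a) ∈ PSet (interpOf M) P := by
  rw [allRelFormula, Language.Formula.realize_iInf]
  simp only [realize_relFormula]
  rfl

lemma exists_sentence_spreads (k m : ℕ) : ∃ σ : (lang (FamilySym k)).Sentence,
    ∀ (A : Type) [(lang (FamilySym k)).Structure A],
      A ⊨ σ ↔ Spreads m (interpOf A : Interp (FamilySym k) A) := by
  let b : (Empty ⊕ (Unit ⊕ Fin m ⊕ Fin m)) ⊕ (Fin k ⊕ Fin k) := .inl (.inr (.inl ()))
  let y (i : Fin m) : (Empty ⊕ (Unit ⊕ Fin m ⊕ Fin m)) ⊕ (Fin k ⊕ Fin k) :=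
    .inl (.inr (.inr (.inl i)))
  let z (i : Fin m) : (Empty ⊕ (Unit ⊕ Fin m ⊕ Fin m)) ⊕ (Fin k ⊕ Fin k) :=
    .inl (.inr (.inr (.inr i)))
  let x (i : Fin k) : (Empty ⊕ (Unit ⊕ Fin m ⊕ Fin m)) ⊕ (Fin k ⊕ Fin k) := .inr (.inl i)
  let x' (i : Fin k) : (Empty ⊕ (Unit ⊕ Fin m ⊕ Fin m)) ⊕ (Fin k ⊕ Fin k) := .inr (.inr i)
  let φ : (lang (FamilySym k)).Formula ((Empty ⊕ (Unit ⊕ Fin m ⊕ Fin m)) ⊕ (Fin k ⊕ Fin k)) :=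
    allRelFormula .dom x ⊓ (allRelFormula .dom x' ⊓ (relFormula .base x' ⊓
      ((relFormula .mem (Fin.cons b x)).not ⊓
        eqTypeFormula (Sum.elim x' y) (Sum.elim x z))))
  let ψ : (lang (FamilySym k)).Formula ((Empty ⊕ (Unit ⊕ Fin m ⊕ Fin m)) ⊕ (Fin k ⊕ Fin k)) :=
    (allRelFormula .dom y ⊓ (allRelFormula .dom z ⊓ eqTypeFormula y z))
  refine ⟨((ψ.imp φ).iExs (Fin k ⊕ Fin k)).iAlls _, fun A _ => ?_⟩
  simp only [Language.Sentence.Realize, Language.Formula.realize_iAlls,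
    Language.Formula.realize_iExs, Language.Formula.realize_imp]
  have hψ : ∀ o i, ψ.Realize (Sum.elim (Sum.elim default o) i : _ → A) ↔
      (∀ a, o (.inr (.inl a)) ∈ PSet (interpOf A : Interp (FamilySym k) A) .dom) ∧
      (∀ a, o (.inr (.inr a)) ∈ PSet (interpOf A : Interp (FamilySym k) A) .dom) ∧
      eqType (fun a => o (.inr (.inl a))) = eqType fun a => o (.inr (.inr a)) := fun o i => by
    simp only [ψ, Language.Formula.realize_inf, realize_allRelFormula, realize_eqTypeFormula]
    rfl
  have hφ : ∀ o i, φ.Realize (Sum.elim (Sum.elim default o) i : _ → A) ↔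
      (∀ a, i (.inl a) ∈ PSet (interpOf A : Interp (FamilySym k) A) .dom) ∧
      (∀ a, i (.inr a) ∈ PSet (interpOf A : Interp (FamilySym k) A) .dom) ∧
      (fun a => i (.inr a)) ∈ (interpOf A : Interp (FamilySym k) A) k .base ∧
      (Fin.cons (o (.inl ())) (fun a => i (.inl a)) : Fin (k + 1) → A) ∉
        (interpOf A : Interp (FamilySym k) A) (k + 1) .mem ∧
      eqType (Sum.elim (fun a => i (.inr a)) fun a => o (.inr (.inl a))) =
        eqType (Sum.elim (fun a => i (.inl a)) fun a => o (.inr (.inr a))) := fun o i => by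
    simp only [φ, Language.Formula.realize_inf, realize_allRelFormula, realize_eqTypeFormula,
      Language.Formula.realize_not, realize_relFormula]
    refine and_congr Iff.rfl (and_congr Iff.rfl (and_congr Iff.rfl (and_congr ?_ ?_)))
    · apply iff_of_eq
      congr 2
      funext a
      induction a using Fin.cases <;> rfl
    · apply iff_of_eq
      congr 2 <;> (funext a; cases a <;> rfl)
  simp only [hψ, hφ]
  constructor
  · intro h b y z hy hz hyz
    obtain ⟨i, hi⟩ := h (Sum.elim (fun _ => b) (Sum.elim y z))
    exact ⟨_, _, hi ⟨hy, hz, hyz⟩⟩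
  · intro h o
    by_cases ho : (∀ a, o (.inr (.inl a)) ∈ PSet (interpOf A : Interp (FamilySym k) A) .dom) ∧
      (∀ a, o (.inr (.inr a)) ∈ PSet (interpOf A : Interp (FamilySym k) A) .dom) ∧
      eqType (fun a => o (.inr (.inl a))) = eqType fun a => o (.inr (.inr a))
    · obtain ⟨x, x', hx⟩ := h (o (.inl ())) _ _ ho.1 ho.2.1 ho.2.2
      exact ⟨Sum.elim x x', fun _ => hx⟩
    · exact ⟨fun _ => o (.inl ()), fun hyz => absurd hyz ho⟩

/-- If a unary predicate defines a copy of `M`, then the relativized dependency holds exactly for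
the copies of the relations on `M` satisfying the dependency. -/
lemma relSem_iff {k : ℕ} {D : DepPred k} (hiso : IsoClosed D) {S : Signature} {P : S 1}
    {M A : Type} {I : Interp S A} {j : M → A} (hj : Function.Injective j)
    (hP : PSet I P = Set.range j) (R : Set (Fin k → A)) :
    relSem D P A I R ↔ ∃ Q, D M Q ∧ R = (fun f i => j (f i)) '' Q := by
  let e : M ≃ PSet I P := (Equiv.ofInjective j hj).trans (Equiv.setCongr hP.symm)
  have he : ∀ m, (e m : A) = j m := fun m => rfl
  constructor
  · rintro ⟨hR, hD⟩
    refine ⟨_, hiso _ _ e.symm _ hD, ?_⟩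
    ext f
    constructor
    · intro hf
      refine ⟨_, ⟨fun i => ⟨f i, hR f hf i⟩, hf, rfl⟩, ?_⟩
      funext i
      simp [← he]
    · rintro ⟨_, ⟨g, hg, rfl⟩, rfl⟩
      simpa [← he] using hg
  · rintro ⟨Q, hQ, rfl⟩
    refine ⟨?_, ?_⟩
    · rintro _ ⟨f, -, rfl⟩ i
      rw [hP]
      exact ⟨_, rfl⟩
    · convert hiso _ _ e _ hQ using 1
      ext g
      constructor
      · rintro ⟨f, hf, hfg⟩
        exact ⟨f, hf, funext fun i => Subtype.ext (congrFun hfg i)⟩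
      · rintro ⟨f, hf, rfl⟩
        exact ⟨f, hf, rfl⟩

/-- Team sentences with a relativized strongly first order, relativizable dependency are
first order. -/
lemma exists_sentence_team {k : ℕ} {D : DepPred k} (hsfo : SFOd D) (hrel : Relativizable1 D)
    {S : Signature} (P : S 1) (φ : TS S Unit fun _ => k) (hs : IsSentence φ) (hp : Plain φ) :
    ∃ σ : (lang S).Sentence, ∀ (A : Type) [Nontrivial A] [(lang S).Structure A],
      A ⊨ σ ↔ TTrue A (interpOf A) (fun _ => relSem D P A (interpOf A)) φ := by
  obtain ⟨ψ, hψs, hψp, hψ⟩ := hrel S P φ hs hp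
  obtain ⟨χ, hχs, hχ⟩ := hsfo S ψ hψs hψp
  obtain ⟨σ, hσ⟩ := exists_sentence χ hχs
  exact ⟨σ, fun A _ _ => by
    rw [hσ, ← hχ A inferInstance, ← hψ A inferInstance]⟩

/-- The interpretation in `A` given by a copy of `M`, a relation on `M`, and a family of relations
on `M` indexed by `A`. -/
def copyInterp {k : ℕ} {M A : Type} (j : M → A) (R : Set (Fin k → M))
    (E : A → Set (Fin k → M)) : Interp (FamilySym k) A := fun n r =>
  match n, r with
  | _, .dom => {f | f 0 ∈ Set.range j}
  | _, .base => (fun f i => j (f i)) '' R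
  | _, .mem => {f | Fin.tail f ∈ (fun g i => j (g i)) '' E (f 0)}

lemma cons_mem_copyInterp {k : ℕ} {M A : Type} {j : M → A} (hj : Function.Injective j)
    (R : Set (Fin k → M)) (E : A → Set (Fin k → M)) (b : A) (g : Fin k → M) :
    (Fin.cons b (fun i => j (g i)) : Fin (k + 1) → A) ∈ copyInterp j R E (k + 1) .mem ↔
      g ∈ E b := by
  change Fin.tail (Fin.cons b (fun i => j (g i)) : Fin (k + 1) → A) ∈ (fun g i => j (g i)) ''
    E ((Fin.cons b (fun i => j (g i)) : Fin (k + 1) → A) 0) ↔ _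
  rw [Fin.tail_cons, Fin.cons_zero]
  exact (hj.comp_left (α := Fin k)).mem_set_image

lemma spreads_copyInterp {k : ℕ} {D : DepPred k} (hiso : IsoClosed D) {M A : Type} [Nonempty M]
    {j : M → A} (hj : Function.Injective j) {R : Set (Fin k → M)} {E : A → Set (Fin k → M)}
    (hE : ∀ b, D M (E b)) {n : ℕ} (hR : ∀ (y : Fin n → M) Q, D M Q → ¬ hull y R ⊆ Q)
    {m : ℕ} (hmn : m ≤ n) : Spreads m (copyInterp j R E) := by
  obtain ⟨c⟩ := ‹Nonempty M›
  intro b y' z' hy' hz' hyz'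
  choose y hy using hy'
  choose z hz using hz'
  obtain rfl : (fun i => j (y i)) = y' := funext hy
  obtain rfl : (fun i => j (z i)) = z' := funext hz
  rw [eqType_comp_injective hj, eqType_comp_injective hj] at hyz'
  obtain ⟨π, hπ⟩ := exists_perm_of_eqType hyz'
  let w : Fin n → M := fun i => if h : (i : ℕ) < m then y ⟨i, h⟩ else c
  have hw : (fun i => w (Fin.castLE hmn i)) = y := funext fun i => by simp [w]
  have hnot := hR w _ (hiso M M π.symm _ (hE b))
  have hsub := hull_subset_hull_comp w (Fin.castLE hmn) R
  rw [hw] at hsub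
  obtain ⟨x, hx, hxE⟩ := Set.not_subset.1 fun h => hnot (hsub.trans h)
  obtain ⟨x', hx', hxx⟩ := hx
  refine ⟨fun i => j (π (x i)), fun i => j (x' i), fun i => ⟨_, rfl⟩, fun i => ⟨_, rfl⟩,
    ⟨x', hx', rfl⟩, fun h => hxE ?_, ?_⟩
  · exact ⟨_, (cons_mem_copyInterp hj R E b fun i => π (x i)).1 h, funext fun i => by simp⟩
  · have h1 : Sum.elim (fun i => j (x' i)) (fun i => j (y i)) =
        fun a => j (Sum.elim x' y a) := by
      funext a
      cases a <;> rfl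
    have h2 : Sum.elim (fun i => j (π (x i))) (fun i => j (z i)) =
        fun a => j (π (Sum.elim x y a)) := by
      funext a
      cases a with
      | inl a => rfl
      | inr a => simp [hπ]
    rw [h1, h2, eqType_comp_injective hj, hxx]
    exact (eqType_comp_injective (hj.comp π.injective) (Sum.elim x y)).symm

/-- There is a uniform bound on the number of parameters over which every relation satisfying
`D` has a hull contained in a relation satisfying `D`. -/
lemma exists_bound_hull_subset {k : ℕ} {D : DepPred k} (hiso : IsoClosed D) (hsfo : SFOd D)
    (hrel : Relativizable1 D) : ∃ n : ℕ, ∀ (M : Type) [Nontrivial M] (R : Set (Fin k → M)),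
      D M R → ∃ (y : Fin n → M) (Q : Set (Fin k → M)), D M Q ∧ hull y R ⊆ Q := by
  by_contra! hcon
  choose M hM R hR hbad using hcon
  obtain ⟨σ, hσ⟩ := exists_sentence_team hsfo hrel .dom (baseSentence k)
    (baseSentence_isSentence k) (baseSentence_plain k)
  obtain ⟨τ, hτ⟩ := exists_sentence_team hsfo hrel .dom (escapeSentence k)
    (escapeSentence_isSentence k) (escapeSentence_plain k)
  choose δ hδ using exists_sentence_spreads k
  let A (n : ℕ) : Type := M n ⊕ ({Q // D (M n) Q} × ℕ)
  let E (n : ℕ) : A n → Set (Fin k → M n) := Sum.elim (fun _ => R n) fun p => p.1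
  have hE : ∀ n b, D (M n) (E n b) := by
    rintro n (b | b)
    · exact hR n
    · exact b.1.2
  have hinf : ∀ n, Infinite (A n) := fun n =>
    Infinite.of_injective (fun i : ℕ => (Sum.inr (⟨R n, hR n⟩, i) : A n)) fun i i' h =>
      congrArg Prod.snd (Sum.inr_injective h)
  let I (n : ℕ) : Interp (FamilySym k) (A n) := copyInterp Sum.inl (R n) (E n)
  let _ (n : ℕ) : (lang (FamilySym k)).Structure (A n) := structOf (I n)
  have hI : ∀ n, interpOf (A n) = I n := fun n => rfl
  have hDA : ∀ n Q, relSem D .dom (A n) (I n) Q ↔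
      ∃ Q', D (M n) Q' ∧ Q = (fun f i => (Sum.inl (f i) : A n)) '' Q' := fun n Q =>
    relSem_iff hiso Sum.inl_injective rfl Q
  obtain ⟨B, _, _, _, hB⟩ := exists_countable_limit (lang (FamilySym k)) A
  let J : Interp (FamilySym k) B := interpOf B
  have hDB : ∀ Q, relSem D .dom B J Q ↔
      ∃ Q', D (PSet J .dom) Q' ∧ Q = (fun f i => (f i : B)) '' Q' := fun Q =>
    relSem_iff hiso Subtype.val_injective Subtype.range_coe.symm Q
  have hbase : relSem D .dom B J (J k .base) := by
    refine (TTrue_baseSentence J _).1 ((hσ B).1 (hB σ (Eventually.of_forall fun n => ?_)))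
    rw [hσ, hI, TTrue_baseSentence, hDA]
    exact ⟨R n, hR n, rfl⟩
  have hescape : ¬ ∃ Q, relSem D .dom B J Q ∧
      ∀ b, ∃ x ∈ Q, (Fin.cons b x : Fin (k + 1) → B) ∉ J (k + 1) .mem := by
    have hBτ : B ⊨ τ.not := hB τ.not (Eventually.of_forall fun n => by
      rw [Language.Sentence.realize_not, hτ, hI, TTrue_escapeSentence]
      rintro ⟨Q, hQ, hesc⟩
      obtain ⟨Q', hQ', rfl⟩ := (hDA n Q).1 hQ
      obtain ⟨_, ⟨x, hx, rfl⟩, hxm⟩ := hesc (Sum.inr (⟨Q', hQ'⟩, 0))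
      exact hxm ((cons_mem_copyInterp Sum.inl_injective _ _ _ _).2 hx))
    rwa [Language.Sentence.realize_not, hτ, TTrue_escapeSentence] at hBτ
  have hspread : ∀ m, Spreads m J := by
    intro m
    refine (hδ m B).1 (hB (δ m) ((eventually_ge_atTop m).mono fun n hn => ?_))
    rw [hδ, hI]
    exact spreads_copyInterp hiso Sum.inl_injective (hE n) (fun y Q hQ => hbad n y Q hQ) hn
  obtain ⟨R₀, hR₀, hbaseR₀⟩ := (hDB _).1 hbase
  obtain ⟨π, hπ⟩ := exists_perm_image_not_subset (N := PSet J .dom) (B := B) R₀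
    (fun b => {g | (Fin.cons b (fun i => (g i : B)) : Fin (k + 1) → B) ∈ J (k + 1) .mem}) (by
      intro b m y z hyz
      obtain ⟨x, x', hx, hx', hxb, hxm, hxx⟩ := hspread m b (fun i => y i) (fun i => z i)
        (fun i => (y i).2) (fun i => (z i).2)
        (by rw [eqType_comp_injective Subtype.val_injective,
          eqType_comp_injective Subtype.val_injective, hyz])
      rw [hbaseR₀] at hxb
      obtain ⟨g', hg', rfl⟩ := hxb
      refine ⟨fun i => ⟨x i, hx i⟩, g', hg', hxm, ?_⟩
      rw [← eqType_comp_injective Subtype.val_injective (Sum.elim g' y),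
        ← eqType_comp_injective Subtype.val_injective (Sum.elim _ z)]
      convert hxx using 2 <;> (funext a; cases a <;> rfl))
  refine hescape ⟨_, (hDB _).2 ⟨_, hiso _ _ π R₀ hR₀, rfl⟩, fun b => ?_⟩
  obtain ⟨x, hx, hxb⟩ := hπ b
  exact ⟨_, ⟨_, ⟨x, hx, rfl⟩, rfl⟩, hxb⟩

end UniformBound

section EqualityTypeFormulas

/-- The conjunction of a list of formulas. -/
def conjEF (l : List EF) : EF := l.foldr .and .top

lemma FSat_conjEF {M : Type} (s : ℕ → M) (l : List EF) :
    FSat M (eI M) s (conjEF l) ↔ ∀ φ ∈ l, FSat M (eI M) s φ := by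
  induction l with
  | nil => simp [conjEF, TS.top, FSat]
  | cons φ l ih =>
    rw [List.forall_mem_cons, ← ih]
    rfl

/-- The disjunction of a list of formulas. -/
def disjEF (l : List EF) : EF := l.foldr .or (.neq 0 0)

lemma FSat_disjEF {M : Type} (s : ℕ → M) (l : List EF) :
    FSat M (eI M) s (disjEF l) ↔ ∃ φ ∈ l, FSat M (eI M) s φ := by
  induction l with
  | nil => simp [disjEF, FSat]
  | cons φ l ih =>
    rw [List.exists_mem_cons_iff, ← ih]
    rfl

open Classical in
/-- The formula over the empty signature stating that the tuple of variables `v` has equality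
type `p`. -/
noncomputable def eqTypeEF {α : Type} [Fintype α] (v : α → ℕ) (p : α → α → Prop) : EF :=
  conjEF ((Finset.univ : Finset (α × α)).toList.map fun q =>
    if p q.1 q.2 then .eq (v q.1) (v q.2) else .neq (v q.1) (v q.2))

lemma FSat_eqTypeEF {α M : Type} [Fintype α] (v : α → ℕ) (p : α → α → Prop) (s : ℕ → M) :
    FSat M (eI M) s (eqTypeEF v p) ↔ eqType (fun a => s (v a)) = p := by
  rw [eqTypeEF, FSat_conjEF, List.forall_mem_map]
  simp only [Finset.mem_toList, Finset.mem_univ, forall_const, Prod.forall]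
  rw [funext_iff]
  refine forall_congr' fun a => ?_
  rw [funext_iff]
  refine forall_congr' fun b => ?_
  by_cases h : p a b <;> simp [h, FSat, eqType]

/-- The formula over the empty signature stating that the equality type of the tuple of
variables `v` lies in `T`. -/
noncomputable def eqTypesEF {α : Type} [Fintype α] (v : α → ℕ) (T : Finset (α → α → Prop)) : EF :=
  disjEF (T.toList.map (eqTypeEF v))

lemma FSat_eqTypesEF {α M : Type} [Fintype α] (v : α → ℕ) (T : Finset (α → α → Prop))
    (s : ℕ → M) : FSat M (eI M) s (eqTypesEF v T) ↔ eqType (fun a => s (v a)) ∈ T := by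
  rw [eqTypesEF, FSat_disjEF]
  simp [FSat_eqTypeEF]

end EqualityTypeFormulas

/-- If `D` is strongly first order and relativizable and
`(M, R) ∈ D`, then `R ⊆ R'` for some `(M, R') ∈ D_max`; moreover there is a
first-order sentence `⋁ᵢ ∃ȳ ∀x̄ (R x̄ ↔ θᵢ(x̄, ȳ))` (the `θᵢ` over the empty
signature) satisfied by every member of `D_max`. -/
theorem max_extension_and_definability {k : ℕ} (D : DepPred k)
    (hiso : IsoClosed D) (hsfo : SFOd D) (hrel : Relativizable1 D)
    (M : Type) [Nontrivial M] (R : Set (Fin k → M)) (hR : D M R) :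
    (∃ R', R ⊆ R' ∧ DMax D M R') ∧
    (∃ (l : ℕ) (θ : Fin l → EF),
      ∀ (N : Type), Nontrivial N → ∀ Q : Set (Fin k → N),
        DMax D N Q → ∃ a : Fin l, ExAllIffSem N Q (θ a)) := by
  classical
  obtain ⟨n, hn⟩ := exists_bound_hull_subset hiso hsfo hrel
  constructor
  · by_contra! hmax
    have hstep : ∀ Q : {Q // R ⊆ Q ∧ D M Q}, ∃ (y : Fin n → M) (Q' : {Q // R ⊆ Q ∧ D M Q}),
        hull y Q.1 ⊂ Q'.1 := by
      rintro ⟨Q, hRQ, hQ⟩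
      obtain ⟨y, Q₁, hQ₁, hsub⟩ := hn M Q hQ
      have hRQ₁ : R ⊆ Q₁ := hRQ.trans ((subset_hull y Q).trans hsub)
      have : ∃ Q₂, Q₁ ⊂ Q₂ ∧ D M Q₂ := by
        by_contra! h
        exact hmax Q₁ hRQ₁ ⟨hQ₁, h⟩
      obtain ⟨Q₂, hlt, hQ₂⟩ := this
      exact ⟨y, ⟨Q₂, hRQ₁.trans hlt.subset, hQ₂⟩, hsub.trans_ssubset hlt⟩
    choose y g hg using hstep
    let Q : ℕ → {Q // R ⊆ Q ∧ D M Q} := fun i => g^[i] ⟨R, subset_rfl, hR⟩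
    refine not_strictMono_hull (fun i => y (Q i)) (fun i => (Q i).1)
      (strictMono_nat_of_lt_succ fun i => ?_)
    have hsucc : Q (i + 1) = g (Q i) := Function.iterate_succ_apply' _ _ _
    refine lt_of_lt_of_le (hg (Q i)) ?_
    rw [hsucc]
    exact subset_hull _ _
  · let e := Finite.equivFin (Finset (Fin k ⊕ Fin n → Fin k ⊕ Fin n → Prop))
    refine ⟨_, fun a => eqTypesEF (Sum.elim Fin.val fun j : Fin n => k + j) (e.symm a), ?_⟩
    intro N _ Q hQ
    obtain ⟨y, Q', hQ', hsub⟩ := hn N Q hQ.1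
    have hull_le : hull y Q ⊆ Q := by
      have : Q = Q' := by
        by_contra hne
        exact hQ.2 Q' (((subset_hull y Q).trans hsub).ssubset_of_ne hne) hQ'
      rwa [← this] at hsub
    obtain ⟨c, -⟩ := exists_pair_ne N
    let s : ℕ → N := fun v => if h : v - k < n then y ⟨v - k, h⟩ else c
    refine ⟨e (Finset.univ.filter fun p => ∃ f ∈ Q, eqType (Sum.elim f y) = p), s, fun f => ?_⟩
    have hs : (fun a => overrideFin k f s ((Sum.elim Fin.val fun j : Fin n => k + j) a)) =
        Sum.elim f y := by
      funext a
      cases a with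
      | inl i => exact overrideFin_val f s i
      | inr j =>
        simp only [Sum.elim_inr]
        rw [overrideFin_of_le _ _ (Nat.le_add_right k j)]
        simp [s]
    beta_reduce
    rw [e.symm_apply_apply, FSat_eqTypesEF, hs, Finset.mem_filter]
    exact ⟨fun hf => ⟨Finset.mem_univ _, f, hf, rfl⟩, fun h => hull_le h.2⟩

end DSFO
end

section
/- Let D be a k-ary generalized dependency, and suppose there exist k-ary relations (Pᵢ)_{i∈ℕ} and (Qᵢ)_{i∈ℕ} over the same domain M such that: (1) (M,Pᵢ) ∈ D for all i; (2) (M,Qᵢ) ∈ ∼D for all i; (3) Pᵢ ⊆ Qᵢ ⊆ P_{i+1} for all i. Then at least one of D and ∼D is not strongly first order. -/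
namespace DSFO

open Filter Function

/-- Iterated universal quantification over a list of variables. -/
def alls {S : Signature} {ι : Type} {ar : ι → ℕ} (l : List ℕ) (φ : TS S ι ar) :
    TS S ι ar := l.foldr TS.al φ

lemma TSat_alls {S : Signature} {ι : Type} {ar : ι → ℕ} {M : Type} (I : Interp S M)
    (A : ∀ i, Set (Fin (ar i) → M) → Prop) (φ : TS S ι ar) (l : List ℕ)
    (X : Set (ℕ → M)) :
    TSat M I A (alls l φ) X ↔
      TSat M I A φ {s' | ∃ s ∈ X, ∀ v, v ∉ l → s' v = s v} := by
  induction l generalizing X with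
  | nil =>
    have h : {s' : ℕ → M | ∃ s ∈ X, ∀ v, v ∉ ([] : List ℕ) → s' v = s v} = X := by
      ext s'
      constructor
      · rintro ⟨s, hs, h⟩
        obtain rfl : s' = s := funext fun v => h v (by simp)
        exact hs
      · exact fun h => ⟨s', h, fun _ _ => rfl⟩
    rw [h]
    rfl
  | cons w l ih =>
    have h : {s' : ℕ → M | ∃ s ∈ {s' | ∃ s ∈ X, ∃ m : M, s' = update s w m}, ∀ v, v ∉ l → s' v = s v} =
        {s' : ℕ → M | ∃ s ∈ X, ∀ v, v ∉ w :: l → s' v = s v} := by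
      ext s'
      constructor
      · rintro ⟨_, ⟨s, hs, m, rfl⟩, h⟩
        refine ⟨s, hs, fun v hv => ?_⟩
        rw [List.mem_cons, not_or] at hv
        rw [h v hv.2, update_of_ne hv.1]
      · rintro ⟨s, hs, h⟩
        refine ⟨_, ⟨s, hs, s' w, rfl⟩, fun v hv => ?_⟩
        by_cases hvw : v = w
        · subst hvw; simp
        · rw [update_of_ne hvw]
          exact h v (by simp [hvw, hv])
    rw [← h]
    exact ih _

lemma fv_alls {S : Signature} {ι : Type} {ar : ι → ℕ} (φ : TS S ι ar) (l : List ℕ) :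
    fv (alls l φ) = fv φ \ {v | v ∈ l} := by
  induction l with
  | nil => simp [alls]
  | cons w l ih =>
    change fv (alls l φ) \ {w} = _
    rw [ih]
    ext v
    simp only [Set.mem_sdiff, Set.mem_ofPred_eq, Set.mem_singleton_iff, List.mem_cons]
    tauto

lemma Plain.alls {S : Signature} {ι : Type} {ar : ι → ℕ} {φ : TS S ι ar} (h : Plain φ)
    (l : List ℕ) : Plain (alls l φ) := by
  induction l with
  | nil => exact h
  | cons w l ih => exact ih

/-- The sentence `∃a ∀x̄ (¬S(x̄,a) ∨ (S(x̄,a) ∧ D x̄))`: for some nonempty set `B`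
of indices, the union of the fibres of `S` over `B` satisfies the atom. -/
def unionFormula (k : ℕ) : TS (SigR (k + 1)) Unit (fun _ => k) :=
  .ex k (alls (List.range k)
    (.or (.nrel (k := k + 1) ⟨rfl⟩ fun i => i)
      (.and (.rel (k := k + 1) ⟨rfl⟩ fun i => i) (.dep () fun j => j))))

lemma isSentence_unionFormula (k : ℕ) : IsSentence (unionFormula k) := by
  refine Set.eq_empty_of_forall_notMem fun v hv => ?_
  simp only [unionFormula, fv, fv_alls, Set.mem_sdiff, Set.mem_union, Set.mem_range,
    Set.mem_ofPred_eq, List.mem_range, Set.mem_singleton_iff] at hv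
  obtain ⟨⟨⟨i, rfl⟩ | ⟨i, rfl⟩ | ⟨i, rfl⟩, h1⟩, h2⟩ := hv <;> omega

lemma plain_unionFormula (k : ℕ) : Plain (unionFormula k) :=
  Plain.alls (φ := .or (.nrel _ _) (.and (.rel _ _) (.dep _ _)))
    ⟨⟨trivial, trivial, trivial⟩, trivial, trivial, trivial⟩ _

lemma TTrue_unionFormula {k : ℕ} {M : Type} [Nonempty M] (I : Interp (SigR (k + 1)) M)
    (A : Unit → Set (Fin k → M) → Prop) :
    TTrue M I A (unionFormula k) ↔ ∃ B : Set M, B.Nonempty ∧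
      A () {x | ∃ b ∈ B, (Fin.snoc x b : Fin (k + 1) → M) ∈ I (k + 1) ⟨rfl⟩} := by
  have snoc_eq : ∀ (s : ℕ → M), (fun i : Fin (k + 1) => s i) =
      Fin.snoc (α := fun _ => M) (fun j : Fin k => s j) (s k) := by
    intro s
    ext i
    refine Fin.lastCases ?_ (fun j => ?_) i <;> simp
  have key : ∀ H : (ℕ → M) → Set M,
      TSat M I A (alls (List.range k)
        (.or (.nrel (k := k + 1) ⟨rfl⟩ fun i => i)
          (.and (.rel (k := k + 1) ⟨rfl⟩ fun i => i) (.dep () fun j => j))))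
        {s' | ∃ s ∈ Set.univ, ∃ m ∈ H s, s' = update s k m} ↔
      A () {x | ∃ b ∈ ⋃ s, H s, (Fin.snoc x b : Fin (k + 1) → M) ∈ I (k + 1) ⟨rfl⟩} := by
    intro H
    rw [TSat_alls]
    set X : Set (ℕ → M) := {s' | ∃ s ∈ {s' | ∃ s ∈ Set.univ, ∃ m ∈ H s, s' = update s k m},
      ∀ v, v ∉ List.range k → s' v = s v} with hX
    have hproj : teamProj (fun j : Fin k => (j : ℕ))
        {s | s ∈ X ∧ (fun i : Fin (k + 1) => s i) ∈ I (k + 1) ⟨rfl⟩} =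
        {x | ∃ b ∈ ⋃ s, H s, (Fin.snoc x b : Fin (k + 1) → M) ∈ I (k + 1) ⟨rfl⟩} := by
      ext x
      constructor
      · rintro ⟨s', ⟨⟨_, ⟨s, -, m, hm, rfl⟩, h⟩, hI⟩, rfl⟩
        have hk : s' k = m := by rw [h k (by simp), update_self]
        refine ⟨m, Set.mem_iUnion.2 ⟨s, hm⟩, ?_⟩
        rw [snoc_eq, hk] at hI
        exact hI
      · rintro ⟨b, hb, hI⟩
        obtain ⟨s, hs⟩ := Set.mem_iUnion.1 hb
        have hx : (fun j : Fin k => overrideFin k x (update s k b) j) = x := by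
          ext j; simp [overrideFin]
        refine ⟨overrideFin k x (update s k b),
          ⟨⟨_, ⟨s, trivial, b, hs, rfl⟩, fun v hv => ?_⟩, ?_⟩, hx.symm⟩
        · simp [overrideFin, List.mem_range.not.1 hv]
        · rw [snoc_eq, hx]
          simpa [overrideFin] using hI
    rw [← hproj]
    constructor
    · rintro ⟨Y, Z, hYZ, hY, hZ, hA⟩
      have : Z = {s | s ∈ X ∧ (fun i : Fin (k + 1) => s i) ∈ I (k + 1) ⟨rfl⟩} := by
        ext s
        refine ⟨fun h => ⟨hYZ ▸ Or.inr h, hZ s h⟩, fun ⟨h, hI⟩ => ?_⟩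
        rw [← hYZ] at h
        exact h.resolve_left fun h' => hY s h' hI
      rw [← this]
      exact hA
    · intro hA
      refine ⟨{s | s ∈ X ∧ (fun i : Fin (k + 1) => s i) ∉ I (k + 1) ⟨rfl⟩}, _, ?_,
        fun s hs => hs.2, fun s hs => hs.2, hA⟩
      ext s
      simp only [Set.mem_union, Set.mem_ofPred_eq]
      tauto
  constructor
  · rintro ⟨H, hne, h⟩
    obtain ⟨m⟩ := ‹Nonempty M›
    obtain ⟨b, hb⟩ := hne (fun _ => m) trivial
    exact ⟨_, ⟨b, Set.mem_iUnion.2 ⟨_, hb⟩⟩, (key H).1 h⟩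
  · rintro ⟨B, hne, h⟩
    refine ⟨fun _ => B, fun _ _ => hne, (key _).2 ?_⟩
    rwa [Set.iUnion_const]

/-- The ultraproduct of a family of interpretations over the same domain. -/
def ultraInterp {S : Signature} {α M : Type} (U : Ultrafilter α) (I : α → Interp S M) :
    Interp S ((U : Filter α).Germ M) :=
  fun k r => {t | ∃ f : Fin k → α → M, (t = fun i => (f i : (U : Filter α).Germ M)) ∧
    ∀ᶠ n in U, (fun i => f i n) ∈ I n k r}

lemma coe_mem_ultraInterp {S : Signature} {α M : Type} (U : Ultrafilter α)
    (I : α → Interp S M) {k : ℕ} (r : S k) (f : Fin k → α → M) :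
    (fun i => (f i : (U : Filter α).Germ M)) ∈ ultraInterp U I k r ↔
      ∀ᶠ n in U, (fun i => f i n) ∈ I n k r := by
  refine ⟨?_, fun h => ⟨f, rfl, h⟩⟩
  rintro ⟨g, hg, h⟩
  have hfg : ∀ᶠ n in (U : Filter α), ∀ i, f i n = g i n :=
    eventually_all.2 fun i => Germ.coe_eq.1 (congrFun hg i)
  filter_upwards [h, hfg] with n hn hfgn
  simpa only [hfgn] using hn

/-- Łoś's theorem for ultraproducts of first-order interpretations. -/
lemma FSat_ultraInterp {S : Signature} {α M : Type} (U : Ultrafilter α)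
    (I : α → Interp S M) (φ : FOF S) (s : ℕ → α → M) :
    FSat ((U : Filter α).Germ M) (ultraInterp U I) (fun v => (s v : (U : Filter α).Germ M)) φ ↔
      ∀ᶠ n in U, FSat M (I n) (fun v => s v n) φ := by
  have hstep : ∀ (φ : FOF S) (s : ℕ → α → M) (v : ℕ) (f : α → M),
      (∀ s : ℕ → α → M, FSat ((U : Filter α).Germ M) (ultraInterp U I)
        (fun v => (s v : (U : Filter α).Germ M)) φ ↔
          ∀ᶠ n in U, FSat M (I n) (fun v => s v n) φ) →
      (FSat ((U : Filter α).Germ M) (ultraInterp U I)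
        (update (fun v => (s v : (U : Filter α).Germ M)) v f) φ ↔
          ∀ᶠ n in U, FSat M (I n) (update (fun w => s w n) v (f n)) φ) := by
    intro φ s v f hφ
    convert hφ (update s v f) using 4
    · next w =>
      by_cases h : w = v
      · subst h; simp
      · simp [h]
    · ext w
      by_cases h : w = v
      · subst h; simp
      · simp [h]
  induction φ generalizing s with
  | rel r v => exact coe_mem_ultraInterp U I r fun i => s (v i)
  | nrel r v =>
    exact (coe_mem_ultraInterp U I r fun i => s (v i)).not.trans Ultrafilter.eventually_not.symm
  | eq x y => exact Germ.coe_eq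
  | neq x y => exact Germ.coe_eq.not.trans Ultrafilter.eventually_not.symm
  | dep i v => exact i.elim
  | and φ ψ hφ hψ => exact (and_congr (hφ s) (hψ s)).trans eventually_and.symm
  | or φ ψ hφ hψ => exact (or_congr (hφ s) (hψ s)).trans Ultrafilter.eventually_or.symm
  | gdisj φ ψ hφ hψ => exact (or_congr (hφ s) (hψ s)).trans Ultrafilter.eventually_or.symm
  | cneg φ hφ => exact (hφ s).not.trans Ultrafilter.eventually_not.symm
  | ex v φ hφ =>
    constructor
    · rintro ⟨m, hm⟩
      induction m using Germ.inductionOn with | _ f => ?_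
      exact ((hstep φ s v f hφ).1 hm).mono fun n hn => ⟨f n, hn⟩
    · intro h
      obtain ⟨f, hf⟩ := h.choice
      exact ⟨f, (hstep φ s v f hφ).2 hf⟩
  | al v φ hφ =>
    constructor
    · intro h
      by_contra hc
      rw [← Ultrafilter.eventually_not] at hc
      simp only [FSat, not_forall] at hc
      obtain ⟨f, hf⟩ := hc.choice
      obtain ⟨n, hn, hn'⟩ := (((hstep φ s v f hφ).1 (h f)).and hf).exists
      exact hn' hn
    · intro h m
      induction m using Germ.inductionOn with | _ f => ?_
      exact (hstep φ s v f hφ).2 (h.mono fun n hn => hn (f n))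

/-- The union of the sets `(Q i)*` over the standard `i : ℕ`, as a relation over
the ultrapower of the domain by the hyperfilter. -/
def standardUnion {k : ℕ} {M : Type} (Q : ℕ → Set (Fin k → M)) :
    Set (Fin k → (hyperfilter ℕ : Filter ℕ).Germ M) :=
  {x | ∃ (f : Fin k → ℕ → M) (i : ℕ),
    (x = fun j => (f j : (hyperfilter ℕ : Filter ℕ).Germ M)) ∧
      ∀ᶠ n in hyperfilter ℕ, (fun j => f j n) ∈ Q i}

lemma standardUnion_subset {k : ℕ} {M : Type} {P Q : ℕ → Set (Fin k → M)}
    (h : ∀ i, ∃ j, P i ⊆ Q j) : standardUnion P ⊆ standardUnion Q := by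
  rintro x ⟨f, i, hx, hf⟩
  obtain ⟨j, hj⟩ := h i
  exact ⟨f, j, hx, hf.mono fun n hn => hj hn⟩

/-- If `D` is strongly first order and fails along an increasing chain over an infinite
domain, then it fails at the standard union of the chain in the ultrapower. -/
lemma SFOd.not_standardUnion {k : ℕ} {D : DepPred k} (hD : SFOd D) {M : Type} [Infinite M]
    {Q : ℕ → Set (Fin k → M)} (hQ : Monotone Q) (hDQ : ∀ i, ¬ D M (Q i)) :
    ¬ D ((hyperfilter ℕ : Filter ℕ).Germ M) (standardUnion Q) := by
  intro hU
  obtain ⟨ψ, -, hψ⟩ := hD _ _ (isSentence_unionFormula k) (plain_unionFormula k)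
  let e := Infinite.natEmbedding M
  let idx : M → ℕ := invFun e
  have hidx : ∀ i, idx (e i) = i := leftInverse_invFun e.injective
  let I : ℕ → Interp (SigR (k + 1)) M := fun n =>
    interpR {t | Fin.init t ∈ Q (min (idx (t (Fin.last k))) n)}
  have hfalse : ∀ n, ¬ FOTrue M (I n) ψ := by
    intro n
    rw [← hψ M inferInstance, TTrue_unionFormula]
    rintro ⟨B, hne, hB⟩
    let J := (fun b => min (idx b) n) '' B
    have hJ : BddAbove J := ⟨n, by rintro _ ⟨b, -, rfl⟩; exact min_le_right _ _⟩
    obtain ⟨b, hb, hbJ⟩ : sSup J ∈ J := Nat.sSup_mem (hne.image _) hJ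
    refine hDQ (sSup J) ?_
    convert hB using 1
    ext x
    have hmem : ∀ b, (Fin.snoc x b : Fin (k + 1) → M) ∈ I n (k + 1) ⟨rfl⟩ ↔
        x ∈ Q (min (idx b) n) := by
      intro b
      change Fin.init (Fin.snoc (α := fun _ => M) x b) ∈
        Q (min (idx (Fin.snoc (α := fun _ => M) x b (Fin.last k))) n) ↔ _
      rw [Fin.init_snoc, Fin.snoc_last]
    simp only [Set.mem_ofPred_eq, hmem]
    constructor
    · intro hx
      exact ⟨b, hb, by rwa [← hbJ] at hx⟩
    · rintro ⟨c, hc, hx⟩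
      exact hQ (le_csSup hJ ⟨c, hc, rfl⟩) hx
  have htrue : FOTrue ((hyperfilter ℕ : Filter ℕ).Germ M) (ultraInterp (hyperfilter ℕ) I) ψ := by
    rw [← hψ _ inferInstance, TTrue_unionFormula]
    refine ⟨Set.range fun i => ((fun _ => e i : ℕ → M) : (hyperfilter ℕ : Filter ℕ).Germ M),
      Set.range_nonempty _, ?_⟩
    convert hU using 1
    have hge : ∀ i, ∀ᶠ n in (hyperfilter ℕ : Filter ℕ), i ≤ n := fun i =>
      Nat.hyperfilter_le_atTop (eventually_ge_atTop i)
    ext x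
    constructor
    · rintro ⟨_, ⟨i, rfl⟩, f, hf, hfQ⟩
      refine ⟨fun j => f j.castSucc, i, ?_, ?_⟩
      · ext j
        simpa using congrFun hf j.castSucc
      · have hlast := congrFun hf (Fin.last k)
        rw [Fin.snoc_last] at hlast
        filter_upwards [hfQ, Germ.coe_eq.1 hlast, hge i] with n hn hl hi
        change (fun j : Fin k => f j.castSucc n) ∈ Q (min (idx (f (Fin.last k) n)) n) at hn
        rwa [← hl, hidx, min_eq_left hi] at hn
    · rintro ⟨f, i, rfl, hf⟩
      refine ⟨_, ⟨i, rfl⟩, Fin.snoc (α := fun _ => ℕ → M) f (fun _ => e i), ?_, ?_⟩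
      · ext j
        refine Fin.lastCases ?_ (fun j => ?_) j <;> simp
      · filter_upwards [hf, hge i] with n hn hi
        change (fun j : Fin k => Fin.snoc (α := fun _ => ℕ → M) f (fun _ => e i) j.castSucc n) ∈
          Q (min (idx (Fin.snoc (α := fun _ => ℕ → M) f (fun _ => e i) (Fin.last k) n)) n)
        simpa [hidx, min_eq_left hi] using hn
  simp only [FOTrue, not_forall] at hfalse
  choose s hs using hfalse
  obtain ⟨n, hn⟩ := ((FSat_ultraInterp _ I ψ fun v n => s n v).1 (htrue _)).exists
  exact hs n hn

/-- If over some domain `M` there are relations `Pᵢ ⊆ Qᵢ ⊆ Pᵢ₊₁`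
with `(M, Pᵢ) ∈ D` and `(M, Qᵢ) ∈ ∼D` for all `i`, then at least one of `D`
and `∼D` is not strongly first order. -/
theorem no_infinite_stair {k : ℕ} (D : DepPred k) (hiso : IsoClosed D)
    (M : Type) [Nontrivial M] (P Q : ℕ → Set (Fin k → M))
    (hP : ∀ i, D M (P i)) (hQ : ∀ i, complD D M (Q i))
    (hPQ : ∀ i, P i ⊆ Q i) (hQP : ∀ i, Q i ⊆ P (i + 1)) :
    ¬ SFOd D ∨ ¬ SFOd (complD D) := by
  have hPm : Monotone P := monotone_nat_of_le_succ fun i => (hPQ i).trans (hQP i)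
  have hQm : Monotone Q := monotone_nat_of_le_succ fun i => (hQP i).trans (hPQ (i + 1))
  have hPs : StrictMono P := strictMono_nat_of_lt_succ fun i =>
    (hPm i.le_succ).lt_of_ne fun h =>
      hQ i ((hPQ i).antisymm (h ▸ hQP i) ▸ hP i)
  have hinf : Infinite M := by
    by_contra h
    rw [not_infinite_iff_finite] at h
    exact not_injective_infinite_finite P hPs.injective
  by_contra! h
  have hU : standardUnion P = standardUnion Q :=
    (standardUnion_subset fun i => ⟨i, hPQ i⟩).antisymm
      (standardUnion_subset fun i => ⟨i + 1, hQP i⟩)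
  refine h.2.not_standardUnion hPm (fun i => not_not_intro (hP i)) ?_
  rw [hU]
  exact h.1.not_standardUnion hQm hQ

end DSFO
end
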